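/- Let X be a finite set with decidable equality and let R ⊆ F(X) be a finite symmetrized set of relators satisfying C''(4) and T(4), with presented group G = ⟨X | R⟩. Then the conjugacy problem for G is decidable: there exists a computable function f taking pairs of words over X to Bool such that f(u, w) = true if and only if the elements of G represented by u and w are conjugate in G. -/

import Mathlib

/-- A *word* over `X` is a finite sequence of letters, where a letter is a generator
`x : X` together with a sign (`true` for `x`, `false` for `x⁻¹`). -/
abbrev Word (X : Type*) := List (X × Bool)

/-- The formal inverse of a letter. -/
def letterInv {X : Type*} (l : X × Bool) : X × Bool := (l.1, !l.2)

/-- The element of the presented group `⟨X | R⟩` represented by a word. -/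
def toG {X : Type*} (R : Set (FreeGroup X)) (w : Word X) : PresentedGroup R :=
  PresentedGroup.mk R (FreeGroup.mk w)

/-- A word is freely reduced if it has no two adjacent mutually inverse letters. -/
def FreelyReduced {X : Type*} (w : Word X) : Prop :=
  w.Chain' fun l₁ l₂ => l₂ ≠ letterInv l₁

/-- A nonempty word `p` is a piece w.r.t. `R` if two distinct relators of `R` both start
with `p` (as reduced words, i.e. products without cancellation). -/
def IsPiece {X : Type*} [DecidableEq X] (R : Set (FreeGroup X)) (p : Word X) : Prop :=
  p ≠ [] ∧ ∃ r ∈ R, ∃ s ∈ R, r ≠ s ∧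
    (∃ u, FreeGroup.toWord r = p ++ u) ∧ (∃ v, FreeGroup.toWord s = p ++ v)

/-- A (reduced) word is cyclically reduced if its last letter is not the inverse
of its first letter. -/
def CyclicallyReducedWord {X : Type*} (w : Word X) : Prop :=
  FreelyReduced w ∧ ¬ ∃ (a : X × Bool) (t : Word X), w = a :: (t ++ [letterInv a])

/-- `R` is symmetrized: every relator is cyclically reduced and `R` is closed under
inversion and under cyclic permutation of reduced words. -/
def Symmetrized {X : Type*} [DecidableEq X] (R : Set (FreeGroup X)) : Prop :=
  (∀ r ∈ R, CyclicallyReducedWord (FreeGroup.toWord r)) ∧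
  (∀ r ∈ R, r⁻¹ ∈ R) ∧
  (∀ r ∈ R, ∀ (a : X × Bool) (t : Word X),
      FreeGroup.toWord r = a :: t → FreeGroup.mk (t ++ [a]) ∈ R)

/-- The C''(4) condition: all relators have length four, and no relator is a product
(without cancellation) of fewer than four pieces. -/
def Cpp4 {X : Type*} [DecidableEq X] (R : Set (FreeGroup X)) : Prop :=
  (∀ r ∈ R, (FreeGroup.toWord r).length = 4) ∧
  (∀ r ∈ R, ¬ ∃ ps : List (Word X), ps.length < 4 ∧ (∀ p ∈ ps, IsPiece R p) ∧
      FreeGroup.toWord r = ps.flatten)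

/-- The product `r * s` is reduced without cancellation. -/
def NoCancel {X : Type*} [DecidableEq X] (r s : FreeGroup X) : Prop :=
  FreeGroup.toWord (r * s) = FreeGroup.toWord r ++ FreeGroup.toWord s

/-- The T(4) condition. -/
def T4 {X : Type*} [DecidableEq X] (R : Set (FreeGroup X)) : Prop :=
  ∀ r₁ ∈ R, ∀ r₂ ∈ R, ∀ r₃ ∈ R,
    r₁ ≠ r₂⁻¹ → r₂ ≠ r₃⁻¹ → r₁ ≠ r₃⁻¹ →
    NoCancel r₁ r₂ ∨ NoCancel r₂ r₃ ∨ NoCancel r₃ r₁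

/-- The word `a t₁⋯tₙ b` is a chain word with inner link path `s₁⋯sₙ` (n ≥ 1):
there are letters `u₀, …, uₙ` with `u₀ = a⁻¹`, `uₙ = b` and `tᵢ uᵢ sᵢ⁻¹ u_{i-1}⁻¹ ∈ R`
for all `i`. -/
def IsChainWord {X : Type*} (R : Set (FreeGroup X))
    (a : X × Bool) (t s : Word X) (b : X × Bool) : Prop :=
  1 ≤ t.length ∧ ∃ hlen : t.length = s.length, ∃ u : ℕ → X × Bool,
    u 0 = letterInv a ∧ u t.length = b ∧
    ∀ i, ∀ hi : i < t.length,
      FreeGroup.mk [t[i], u (i + 1), letterInv (s[i]'(hlen ▸ hi)), letterInv (u i)] ∈ R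

/-- A word is geodesic if no strictly shorter word represents the same element of the
presented group. -/
def Geodesic {X : Type*} (R : Set (FreeGroup X)) (w : Word X) : Prop :=
  ∀ v : Word X, toG R v = toG R w → w.length ≤ v.length

/-- A word is cyclically geodesic if all of its cyclic permutations are geodesic. -/
def CyclicallyGeodesic {X : Type*} (R : Set (FreeGroup X)) (w : Word X) : Prop :=
  ∀ n : ℕ, Geodesic R (w.rotate n)

/-- A pair is a two-letter contiguous subword of (the reduced word of) a relator of `R`. -/
def IsPair {X : Type*} [DecidableEq X] (R : Set (FreeGroup X)) (l₁ l₂ : X × Bool) : Prop :=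
  ∃ r ∈ R, [l₁, l₂] <:+: FreeGroup.toWord r

/-- `P` holds for all cyclically-consecutive entries of `w`. -/
def CyclicAdj {X : Type*} (P : (X × Bool) → (X × Bool) → Prop) (w : Word X) : Prop :=
  ∀ i, ∀ hi : i < w.length,
    P (w[i]) (w[(i + 1) % w.length]'(Nat.mod_lt _ (by omega)))

/-- The presentation has parity with respect to `par : X → Bool` (`true` = white,
`false` = black) if in every relator, read cyclically, consecutive letters have
opposite parities. -/
def HasParity {X : Type*} [DecidableEq X] (R : Set (FreeGroup X)) (par : X → Bool) : Prop :=
  ∀ r ∈ R, CyclicAdj (fun l₁ l₂ => par l₁.1 ≠ par l₂.1) (FreeGroup.toWord r)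

/-- The presentation is alternating: in every relator, read cyclically, letters of
exponent `+1` and exponent `-1` alternate. -/
def AlternatingPresentation {X : Type*} [DecidableEq X] (R : Set (FreeGroup X)) : Prop :=
  ∀ r ∈ R, CyclicAdj (fun l₁ l₂ => l₁.2 ≠ l₂.2) (FreeGroup.toWord r)

/-- A word alternates in sign if adjacent letters have opposite exponents. -/
def AlternatesInSign {X : Type*} (w : Word X) : Prop :=
  w.Chain' fun l₁ l₂ => l₁.2 ≠ l₂.2

/-- A pair exchange: if `x₁x₂x₃x₄ ∈ R`, replace an occurrence of the contiguous subword
`x₁x₂` by `x₄⁻¹x₃⁻¹`. -/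
def PairExchange {X : Type*} (R : Set (FreeGroup X)) (v w : Word X) : Prop :=
  ∃ (p q : Word X) (x₁ x₂ x₃ x₄ : X × Bool),
    FreeGroup.mk [x₁, x₂, x₃, x₄] ∈ R ∧
    v = p ++ [x₁, x₂] ++ q ∧ w = p ++ [letterInv x₄, letterInv x₃] ++ q

/-- A free reduction deletes an adjacent mutually inverse pair of letters. -/
def FreeReductionStep {X : Type*} (v w : Word X) : Prop :=
  ∃ (p q : Word X) (l : X × Bool), v = p ++ [l, letterInv l] ++ q ∧ w = p ++ q

/-- A chain collapse replaces a contiguous chain word subword by its inner link path. -/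
def ChainCollapseStep {X : Type*} (R : Set (FreeGroup X)) (v w : Word X) : Prop :=
  ∃ (p q : Word X) (a b : X × Bool) (t s : Word X),
    IsChainWord R a t s b ∧ v = p ++ (a :: (t ++ [b])) ++ q ∧ w = p ++ s ++ q

/-- A chain flip replaces one side of a conjugacy chain by the other: it replaces the
whole word `s₁⋯sₙ` by `t₁⋯tₙ` (or vice versa) where, for some letter `a`, the word
`a t₁⋯tₙ a⁻¹` is a chain word with inner link path `s₁⋯sₙ`. -/
def ChainFlip {X : Type*} (R : Set (FreeGroup X)) (v w : Word X) : Prop :=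
  ∃ a : X × Bool, IsChainWord R a w v (letterInv a) ∨ IsChainWord R a v w (letterInv a)

/-- Oriented squares over an alphabet with involution: `Sq x x' y y'` says that the two-letter
words `x x'` and `y y'` are the two halves of the boundary of a square. -/
structure SquareSystem (A : Type*) where
  inv : A → A
  inv_inv : ∀ a, inv (inv a) = a
  Sq : A → A → A → A → Prop
  symm : ∀ {x x' y y'}, Sq x x' y y' → Sq y y' x x'
  turn : ∀ {x x' y y'}, Sq x x' y y' → Sq (inv x) y x' (inv y')
  unique : ∀ {x x' y y' z z'}, Sq x x' y y' → Sq x x' z z' → y = z ∧ y' = z'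
  reduced : ∀ {x x' y y'}, Sq x x' y y' → x' ≠ inv x
  no_triangle : ∀ {x y z x₁ y₁ y₂ z₁ x₂ z₂},
    Sq x x₁ y y₁ → Sq y y₂ z z₁ → Sq x x₂ z z₂ → False

namespace SquareSystem

variable {A : Type*} (S : SquareSystem A)

theorem corner_unique {p p₁ p₂ q q₁ q₂ : A} (h₁ : S.Sq p p₁ q q₁) (h₂ : S.Sq p p₂ q q₂) :
    p₁ = p₂ ∧ q₁ = q₂ := by
  obtain ⟨h, h'⟩ := S.unique (S.turn h₁) (S.turn h₂)
  refine ⟨h, ?_⟩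
  rw [← S.inv_inv q₁, h', S.inv_inv]

theorem inverse {x x' y y' : A} (h : S.Sq x x' y y') :
    S.Sq (S.inv x') (S.inv x) (S.inv y') (S.inv y) :=
  S.turn (S.symm (S.turn h))

theorem ne_head {x x' y y' : A} (h : S.Sq x x' y y') : x ≠ y := by
  rintro rfl
  exact S.reduced (S.turn h) (S.inv_inv x).symm

/-- A single exchange of two halves of a square inside a word. -/
inductive Exchange : List A → List A → Prop
  | head {x x' y y' : A} (w : List A) : S.Sq x x' y y' → Exchange (x :: x' :: w) (y :: y' :: w)
  | cons (x : A) {v w : List A} : Exchange v w → Exchange (x :: v) (x :: w)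

theorem Exchange.symm {v w : List A} (h : S.Exchange v w) : S.Exchange w v := by
  induction h with
  | head w h => exact .head w (S.symm h)
  | cons x _ ih => exact .cons x ih

theorem Exchange.length_eq {v w : List A} (h : S.Exchange v w) : v.length = w.length := by
  induction h with
  | head w h => rfl
  | cons x _ ih => simp [ih]

/-- Equivalence of words under exchanges. -/
abbrev ExEquiv : List A → List A → Prop := Relation.ReflTransGen S.Exchange

theorem ExEquiv.symm {v w : List A} (h : S.ExEquiv v w) : S.ExEquiv w v := by
  induction h with
  | refl => exact .refl
  | tail _ h ih => exact .head (Exchange.symm S h) ih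

theorem ExEquiv.cons {v w : List A} (x : A) (h : S.ExEquiv v w) : S.ExEquiv (x :: v) (x :: w) :=
  Relation.ReflTransGen.lift (x :: ·) (fun _ _ h => Exchange.cons x h) _ _ h

theorem ExEquiv.length_eq {v w : List A} (h : S.ExEquiv v w) : v.length = w.length := by
  induction h with
  | refl => rfl
  | tail _ h ih => exact ih.trans (Exchange.length_eq S h)

theorem exEquiv_cons {x y : A} {v w : List A} (h : S.ExEquiv (x :: v) (y :: w)) :
    x = y ∧ S.ExEquiv v w ∨
      ∃ x' y' u, S.ExEquiv v (x' :: u) ∧ S.ExEquiv w (y' :: u) ∧ S.Sq x x' y y' := by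
  induction hn : v.length using Nat.strong_induction_on generalizing x y v w with
  | _ n IH =>
    generalize hb : y :: w = b at h
    induction h generalizing y w with
    | refl =>
      obtain ⟨rfl, rfl⟩ := List.cons.inj hb
      exact .inl ⟨rfl, .refl⟩
    | @tail c d hc hcd ih =>
      subst hb
      cases hcd with
      | cons _ hs =>
        rcases ih rfl with ⟨rfl, h⟩ | ⟨x', y', u, h₁, h₂, h₃⟩
        · exact .inl ⟨rfl, h.tail hs⟩
        · exact .inr ⟨x', y', u, h₁, .head (Exchange.symm S hs) h₂, h₃⟩
      | @head z z' _ y' w hs =>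
        rcases ih rfl with ⟨rfl, h⟩ | ⟨x', t, u, h₁, h₂, h₃⟩
        · exact .inr ⟨z', y', w, h, .refl, hs⟩
        · have hl : v.length = w.length + 1 := by
            have := ExEquiv.length_eq S hc
            simpa using this
          rcases IH w.length (by omega) h₂ rfl with ⟨rfl, h⟩ | ⟨p, q, u', -, -, h₄⟩
          · obtain ⟨rfl, rfl⟩ := S.unique (S.symm h₃) hs
            exact .inl ⟨rfl, h₁.trans (ExEquiv.cons S _ (ExEquiv.symm S h))⟩
          · exact (S.no_triangle (S.turn hs) h₄ (S.turn (S.symm h₃))).elim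

/-- Exchange equivalence as a setoid. -/
def setoid : Setoid (List A) :=
  ⟨S.ExEquiv, fun _ => .refl, ExEquiv.symm S, fun h₁ h₂ => h₁.trans h₂⟩

/-- Words modulo exchanges. -/
def Cls : Type _ := Quotient S.setoid

/-- The class of a word. -/
def cls (w : List A) : S.Cls := Quotient.mk S.setoid w

/-- Prepending a letter to a class. -/
def cons (a : A) : S.Cls → S.Cls :=
  Quotient.map (a :: ·) fun _ _ h => ExEquiv.cons S a h

/-- The length of a class. -/
def length : S.Cls → ℕ :=
  Quotient.lift List.length fun _ _ h => ExEquiv.length_eq S h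

@[simp] theorem length_cls (w : List A) : S.length (S.cls w) = w.length := rfl

@[simp] theorem length_cons (a : A) (p : S.Cls) : S.length (S.cons a p) = S.length p + 1 := by
  induction p using Quotient.inductionOn with | h w => rfl

theorem exists_cls (p : S.Cls) : ∃ w, p = S.cls w := by
  induction p using Quotient.inductionOn with | h w => exact ⟨w, rfl⟩

theorem eq_nil_or_cons (p : S.Cls) : p = S.cls [] ∨ ∃ a q, p = S.cons a q := by
  obtain ⟨w, rfl⟩ := S.exists_cls p
  cases w with
  | nil => exact .inl rfl
  | cons a w => exact .inr ⟨a, S.cls w, rfl⟩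

theorem cons_ne_nil (a : A) (p : S.Cls) : S.cons a p ≠ S.cls [] := fun h => by
  simpa using congrArg S.length h

theorem cons_cons_eq {x x' y y' : A} (h : S.Sq x x' y y') (p : S.Cls) :
    S.cons x (S.cons x' p) = S.cons y (S.cons y' p) := by
  obtain ⟨w, rfl⟩ := S.exists_cls p
  exact Quotient.sound (s := S.setoid) (.single (.head w h))

theorem cons_eq_cons {x y : A} {p q : S.Cls} (h : S.cons x p = S.cons y q) :
    x = y ∧ p = q ∨ ∃ x' y' r, p = S.cons x' r ∧ q = S.cons y' r ∧ S.Sq x x' y y' := by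
  obtain ⟨v, rfl⟩ := S.exists_cls p
  obtain ⟨w, rfl⟩ := S.exists_cls q
  rcases S.exEquiv_cons (Quotient.exact (s := S.setoid) h) with ⟨h, h'⟩ | ⟨x', y', u, h₁, h₂, h₃⟩
  · exact .inl ⟨h, Quotient.sound (s := S.setoid) h'⟩
  · exact .inr ⟨x', y', S.cls u, Quotient.sound (s := S.setoid) h₁,
      Quotient.sound (s := S.setoid) h₂, h₃⟩

theorem cons_injective (a : A) : Function.Injective (S.cons a) := fun p q h => by
  rcases S.cons_eq_cons h with ⟨-, h⟩ | ⟨x', y', r, -, -, h⟩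
  · exact h
  · exact (S.ne_head h rfl).elim

/-- A class is reducible if one of its words contains a cancelling pair. -/
inductive Reducible : S.Cls → Prop
  | head (x : A) (p : S.Cls) : Reducible (S.cons x (S.cons (S.inv x) p))
  | cons (a : A) {p : S.Cls} : Reducible p → Reducible (S.cons a p)

theorem not_reducible_nil : ¬ S.Reducible (S.cls []) := by
  intro h
  generalize hq : S.cls [] = q at h
  cases h with
  | head x p => exact S.cons_ne_nil _ _ hq.symm
  | cons a h => exact S.cons_ne_nil _ _ hq.symm

theorem Reducible.of_cons {a : A} {p : S.Cls} (hp : ¬ S.Reducible p)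
    (h : S.Reducible (S.cons a p)) : ∃ q, p = S.cons (S.inv a) q := by
  induction hn : S.length p using Nat.strong_induction_on generalizing a p with
  | _ n IH =>
    generalize hq : S.cons a p = q at h
    cases h with
    | head x q =>
      rcases S.cons_eq_cons hq with ⟨rfl, h⟩ | ⟨a', y', r, rfl, h₂, h₃⟩
      · exact ⟨q, h⟩
      · rcases S.cons_eq_cons h₂ with ⟨h, -⟩ | ⟨x₂, y₂, q₀, -, rfl, h₄⟩
        · exact (S.reduced (S.symm h₃) h.symm).elim
        · obtain ⟨rfl, rfl⟩ := S.corner_unique h₄ (S.turn (S.symm h₃))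
          exact (hp (.head _ _)).elim
    | @cons b q hr =>
      rcases S.cons_eq_cons hq with ⟨rfl, rfl⟩ | ⟨a', y', r, rfl, rfl, h₃⟩
      · exact (hp hr).elim
      · obtain ⟨s, rfl⟩ := IH (S.length r) (by simp at hn; omega)
          (fun h => hp (.cons _ h)) hr rfl
        exact ⟨S.cons b s, S.cons_cons_eq (S.symm (S.turn h₃)) s⟩

open Classical in
/-- Left multiplication of a class by a letter, with cancellation when possible. -/
noncomputable def act (a : A) (p : S.Cls) : S.Cls :=
  if h : ∃ q, p = S.cons (S.inv a) q then h.choose else S.cons a p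

theorem act_cons_inv (a : A) (q : S.Cls) : S.act a (S.cons (S.inv a) q) = q := by
  have h : ∃ q', S.cons (S.inv a) q = S.cons (S.inv a) q' := ⟨q, rfl⟩
  rw [act, dif_pos h]
  exact (S.cons_injective _ h.choose_spec).symm

theorem act_inv_cons (a : A) (q : S.Cls) : S.act (S.inv a) (S.cons a q) = q := by
  simpa only [S.inv_inv] using S.act_cons_inv (S.inv a) q

theorem act_of_not {a : A} {p : S.Cls} (h : ¬ ∃ q, p = S.cons (S.inv a) q) :
    S.act a p = S.cons a p := by
  rw [act, dif_neg h]

theorem not_reducible_act (a : A) {p : S.Cls} (hp : ¬ S.Reducible p) :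
    ¬ S.Reducible (S.act a p) := by
  by_cases h : ∃ q, p = S.cons (S.inv a) q
  · obtain ⟨q, rfl⟩ := h
    rw [act_cons_inv]
    exact fun h => hp (.cons _ h)
  · rw [S.act_of_not h]
    exact fun h' => h (Reducible.of_cons S hp h')

theorem act_inv_act (a : A) {p : S.Cls} (hp : ¬ S.Reducible p) :
    S.act (S.inv a) (S.act a p) = p := by
  by_cases h : ∃ q, p = S.cons (S.inv a) q
  · obtain ⟨q, rfl⟩ := h
    rw [act_cons_inv]
    apply S.act_of_not
    rintro ⟨r, rfl⟩
    exact hp (.head _ _)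
  · rw [S.act_of_not h, act_inv_cons]

theorem act_square_of_cons {x x' y y' : A} (h : S.Sq x x' y y') {p : S.Cls}
    (hq : ¬ ∃ q, S.cons (S.inv x') p = S.cons (S.inv y') q) :
    S.act x (S.act x' (S.cons (S.inv x') p)) = S.act y (S.act y' (S.cons (S.inv x') p)) := by
  rw [act_cons_inv, S.act_of_not hq,
    S.cons_cons_eq (S.symm (S.turn (S.symm h))) p, act_cons_inv]
  apply S.act_of_not
  rintro ⟨r, rfl⟩
  exact hq ⟨_, S.cons_cons_eq (S.inverse h) r⟩

theorem act_square {x x' y y' : A} (h : S.Sq x x' y y') {p : S.Cls} (hp : ¬ S.Reducible p) :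
    S.act x (S.act x' p) = S.act y (S.act y' p) := by
  by_cases h₁ : ∃ q, p = S.cons (S.inv x') q <;> by_cases h₂ : ∃ q, p = S.cons (S.inv y') q
  · obtain ⟨q, rfl⟩ := h₁
    obtain ⟨q', hq⟩ := h₂
    rcases S.cons_eq_cons hq with ⟨h', -⟩ | ⟨s, t, r, rfl, rfl, hs⟩
    · exact (S.ne_head (S.inverse h) h').elim
    · obtain ⟨rfl, rfl⟩ := S.corner_unique hs (S.inverse h)
      rw [act_cons_inv, act_cons_inv, hq, act_cons_inv, act_cons_inv]
  · obtain ⟨q, rfl⟩ := h₁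
    exact S.act_square_of_cons h h₂
  · obtain ⟨q, rfl⟩ := h₂
    exact (S.act_square_of_cons (S.symm h) h₁).symm
  · have key : ∀ {x x' y y'}, S.Sq x x' y y' → (¬ ∃ q, p = S.cons (S.inv y') q) →
        S.act x (S.cons x' p) = S.cons x (S.cons x' p) := by
      intro x x' y y' h h₂
      apply S.act_of_not
      rintro ⟨q, hq⟩
      rcases S.cons_eq_cons hq with ⟨h', -⟩ | ⟨s, t, r, rfl, rfl, hs⟩
      · exact S.reduced h h'
      · obtain ⟨rfl, rfl⟩ := S.corner_unique hs (S.symm (S.turn h))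
        exact h₂ ⟨_, rfl⟩
    rw [S.act_of_not h₁, S.act_of_not h₂, key h h₂, key (S.symm h) h₁, S.cons_cons_eq h]

/-- The irreducible classes. -/
def Irred : Type _ := {p : S.Cls // ¬ S.Reducible p}

/-- The permutation of the irreducible classes given by a letter. -/
noncomputable def perm (a : A) : Equiv.Perm S.Irred where
  toFun p := ⟨S.act a p.1, S.not_reducible_act a p.2⟩
  invFun p := ⟨S.act (S.inv a) p.1, S.not_reducible_act _ p.2⟩
  left_inv p := Subtype.ext (S.act_inv_act a p.2)
  right_inv p := Subtype.ext (by
    have := S.act_inv_act (S.inv a) p.2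
    rwa [S.inv_inv] at this)

theorem perm_inv (a : A) : S.perm (S.inv a) = (S.perm a)⁻¹ :=
  Equiv.ext fun _ => Subtype.ext rfl

theorem perm_square {x x' y y' : A} (h : S.Sq x x' y y') :
    S.perm x * S.perm x' = S.perm y * S.perm y' :=
  Equiv.ext fun p => Subtype.ext (S.act_square h p.2)

end SquareSystem

/-- A group generated by the letters of a square system, with a length function satisfying the
quadrangle condition. -/
structure SquareLength {A : Type*} (S : SquareSystem A) (G : Type*) [Group G] where
  gen : A → G
  len : G → ℕ
  gen_inv : ∀ a, gen (S.inv a) = (gen a)⁻¹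
  gen_square : ∀ {x x' y y'}, S.Sq x x' y y' → gen x * gen x' = gen y * gen y'
  len_eq_zero : ∀ {g}, len g = 0 ↔ g = 1
  len_gen_mul : ∀ a g, len (gen a * g) = len g + 1 ∨ len (gen a * g) + 1 = len g
  len_inv : ∀ g, len g⁻¹ = len g
  len_mul_le : ∀ g h, len (g * h) ≤ len g + len h
  exists_descent : ∀ {g}, g ≠ 1 → ∃ a, len ((gen a)⁻¹ * g) + 1 = len g
  exists_square : ∀ {x y g}, x ≠ y → len ((gen x)⁻¹ * g) + 1 = len g →
    len ((gen y)⁻¹ * g) + 1 = len g →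
    ∃ x' y', S.Sq x x' y y' ∧ len ((gen x * gen x')⁻¹ * g) + 2 = len g

namespace SquareLength

variable {A : Type*} {S : SquareSystem A} {G : Type*} [Group G] (L : SquareLength S G)

theorem len_one : L.len 1 = 0 := L.len_eq_zero.2 rfl

theorem len_gen_le (a : A) : L.len (L.gen a) ≤ 1 := by
  have := L.len_gen_mul a 1
  rw [mul_one, L.len_one] at this
  omega

theorem len_mul_gen (a : A) (g : G) :
    L.len (g * L.gen a) = L.len g + 1 ∨ L.len (g * L.gen a) + 1 = L.len g := by
  have := L.len_gen_mul (S.inv a) g⁻¹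
  rwa [L.gen_inv, ← mul_inv_rev, L.len_inv, L.len_inv] at this

/-- The letter `a` starts a shortest word for `g`. -/
def Descent (a : A) (g : G) : Prop := L.len ((L.gen a)⁻¹ * g) + 1 = L.len g

theorem len_of_not_descent {a : A} {g : G} (h : ¬ L.Descent a g) :
    L.len ((L.gen a)⁻¹ * g) = L.len g + 1 := by
  have := L.len_gen_mul (S.inv a) g
  rw [L.gen_inv] at this
  exact this.resolve_right h

theorem descent_of_le {a : A} {g : G} (h : L.len ((L.gen a)⁻¹ * g) ≤ L.len g) :
    L.Descent a g := by
  by_contra h'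
  have := L.len_of_not_descent h'
  omega

theorem not_descent_one (a : A) : ¬ L.Descent a 1 := by
  simp [Descent, L.len_one]

theorem Descent.mul_gen {L : SquareLength S G} {b c : A} {h : G} (hb : L.Descent b h)
    (hc : L.len (h * L.gen c) = L.len h + 1) : L.Descent b (h * L.gen c) := by
  apply L.descent_of_le
  have h₁ := L.len_mul_gen c ((L.gen b)⁻¹ * h)
  rw [mul_assoc] at h₁
  unfold Descent at hb
  omega

theorem eq_of_three_descents {x y z : A} {g : G} (hx : L.Descent x g) (hy : L.Descent y g)
    (hz : L.Descent z g) (hxy : x ≠ y) : z = x ∨ z = y := by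
  by_contra! h
  obtain ⟨_, _, h₁, -⟩ := L.exists_square hxy hx hy
  obtain ⟨_, _, h₂, -⟩ := L.exists_square h.2.symm hy hz
  obtain ⟨_, _, h₃, -⟩ := L.exists_square h.1.symm hx hz
  exact S.no_triangle h₁ h₂ h₃

theorem len_of_square {x x' y y' : A} {g : G} (hx : L.Descent x g) (hy : L.Descent y g)
    (h : S.Sq x x' y y') : L.len ((L.gen x * L.gen x')⁻¹ * g) + 2 = L.len g := by
  obtain ⟨_, _, h₁, h₂⟩ := L.exists_square (S.ne_head h) hx hy
  obtain ⟨rfl, rfl⟩ := S.corner_unique h h₁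
  exact h₂

theorem Descent.of_square {L : SquareLength S G} {x x' l l' : A} {g : G} (hx : L.Descent x g)
    (h : S.Sq x x' l l') (hx' : L.Descent x' ((L.gen x)⁻¹ * g)) : L.Descent l g := by
  apply L.descent_of_le
  have e : (L.gen l)⁻¹ * g = L.gen l' * ((L.gen x')⁻¹ * ((L.gen x)⁻¹ * g)) := by
    rw [← mul_assoc (L.gen x')⁻¹, ← mul_inv_rev, L.gen_square h]
    group
  have := L.len_gen_mul l' ((L.gen x')⁻¹ * ((L.gen x)⁻¹ * g))
  rw [e]
  unfold Descent at hx hx'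
  omega

/-- One step of the greedy normal form: remove from `g` the product of all its descents. -/
inductive Next : G → G → Prop
  | one : Next 1 1
  | single {a : A} {g : G} : L.Descent a g → (∀ b, L.Descent b g → b = a) →
      Next g ((L.gen a)⁻¹ * g)
  | pair {x x' y y' : A} {g : G} : L.Descent x g → L.Descent y g → S.Sq x x' y y' →
      Next g ((L.gen x * L.gen x')⁻¹ * g)

theorem exists_next (g : G) : ∃ t, L.Next g t := by
  by_cases hg : g = 1
  · subst hg
    exact ⟨1, .one⟩
  obtain ⟨a, ha⟩ := L.exists_descent hg
  by_cases h : ∀ b, L.Descent b g → b = a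
  · exact ⟨_, .single ha h⟩
  · push Not at h
    obtain ⟨b, hb, hba⟩ := h
    obtain ⟨_, _, h, -⟩ := L.exists_square hba hb ha
    exact ⟨_, .pair hb ha h⟩

theorem Next.unique {L : SquareLength S G} {g t t' : G} (h : L.Next g t) (h' : L.Next g t') :
    t = t' := by
  cases h with
  | one =>
    cases h' with
    | one => rfl
    | single h => exact (L.not_descent_one _ h).elim
    | pair h => exact (L.not_descent_one _ h).elim
  | single h hu =>
    cases h' with
    | one => exact (L.not_descent_one _ h).elim
    | single h' => rw [hu _ h']
    | pair hx hy hs => exact (S.ne_head hs ((hu _ hx).trans (hu _ hy).symm)).elim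
  | @pair x x' y y' _ hx hy hs =>
    cases h' with
    | one => exact (L.not_descent_one _ hx).elim
    | single h' hu => exact (S.ne_head hs ((hu _ hx).trans (hu _ hy).symm)).elim
    | @pair z z' w w' _ hz hw hs' =>
      have hzw := S.ne_head hs'
      rcases L.eq_of_three_descents hx hy hz (S.ne_head hs) with rfl | rfl
      · obtain rfl := (L.eq_of_three_descents hx hy hw (S.ne_head hs)).resolve_left hzw.symm
        obtain ⟨rfl, rfl⟩ := S.corner_unique hs hs'
        rfl
      · obtain rfl := (L.eq_of_three_descents hx hy hw (S.ne_head hs)).resolve_right hzw.symm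
        obtain ⟨rfl, rfl⟩ := S.corner_unique hs (S.symm hs')
        rw [L.gen_square hs]

theorem Next.len_lt {L : SquareLength S G} {g t : G} (h : L.Next g t) (hg : g ≠ 1) :
    L.len t < L.len g := by
  cases h with
  | one => exact (hg rfl).elim
  | single h => unfold Descent at h; omega
  | pair hx hy hs => have := L.len_of_square hx hy hs; omega

theorem Next.eq_one {L : SquareLength S G} {g t : G} (h : L.Next g t) (hg : L.len g ≤ 1) :
    t = 1 := by
  by_cases h1 : g = 1
  · subst h1
    exact h.unique .one
  · have := h.len_lt h1
    exact L.len_eq_zero.1 (by omega)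

theorem Next.len_mul_inv_le {L : SquareLength S G} {g t : G} (h : L.Next g t) :
    L.len (t * g⁻¹) ≤ 2 := by
  cases h with
  | one => simp [L.len_one]
  | @single a =>
    rw [mul_inv_cancel_right, L.len_inv]
    exact (L.len_gen_le a).trans one_le_two
  | @pair x x' =>
    rw [mul_inv_cancel_right, L.len_inv]
    have h := add_le_add (L.len_gen_le x) (L.len_gen_le x')
    exact (L.len_mul_le _ _).trans h

/-- The relation between corresponding stages of the normal forms of `g` and `g * gen a`. -/
def RightFellow (a : A) (g g' : G) : Prop :=
  (g' = g * L.gen a ∧ L.len g' = L.len g + 1) ∨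
  (∃ l, g' = (L.gen l)⁻¹ * (g * L.gen a) ∧ L.len (g * L.gen a) = L.len g + 1 ∧
    ¬ L.Descent l g ∧ L.len g' = L.len g) ∨
  (g = 1 ∧ g' = 1)

theorem RightFellow.next {L : SquareLength S G} {a : A} {g g' t t' : G}
    (h : L.RightFellow a g g') (ht : L.Next g t) (ht' : L.Next g' t') :
    L.RightFellow a t t' := by
  rcases h with ⟨rfl, hl⟩ | ⟨l, rfl, hl, hd, he⟩ | ⟨rfl, rfl⟩
  · cases ht with
    | one =>
      exact .inr (.inr ⟨rfl, ht'.eq_one (by rw [hl, L.len_one])⟩)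
    | @single x _ hx hu =>
      have hx' := hx.mul_gen hl
      by_cases hex : ∀ b, L.Descent b (g * L.gen a) → b = x
      · obtain rfl := ht'.unique (.single hx' hex)
        refine .inl ⟨(mul_assoc _ _ _).symm, ?_⟩
        unfold Descent at hx hx'
        omega
      · push Not at hex
        obtain ⟨l, hl', hne⟩ := hex
        obtain ⟨x', l', hs, hlen⟩ := L.exists_square hne.symm hx' hl'
        obtain rfl := ht'.unique (.pair hx' hl' hs)
        refine .inr (.inl ⟨x', by group, ?_, fun h => hne (hu _ (hx.of_square hs h)), ?_⟩)
        · rw [mul_assoc]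
          unfold Descent at hx hx'
          omega
        · unfold Descent at hx
          omega
    | @pair x x' y y' _ hx hy hs =>
      have hx' := hx.mul_gen hl
      have hy' := hy.mul_gen hl
      obtain rfl := ht'.unique (.pair hx' hy' hs)
      have h₁ := L.len_of_square hx hy hs
      have h₂ := L.len_of_square hx' hy' hs
      exact .inl ⟨(mul_assoc _ _ _).symm, by omega⟩
  · have hl' : L.Descent l (g * L.gen a) := by
      unfold Descent
      omega
    cases ht with
    | one =>
      exact .inr (.inr ⟨rfl, ht'.eq_one (by rw [he, L.len_one]; exact zero_le_one)⟩)
    | @single x _ hx hu =>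
      have hx' := hx.mul_gen hl
      have hne : x ≠ l := by
        rintro rfl
        exact hd hx
      obtain ⟨x', l', hs, hlen⟩ := L.exists_square hne hx' hl'
      have e : (L.gen l')⁻¹ * ((L.gen l)⁻¹ * (g * L.gen a)) =
          (L.gen x * L.gen x')⁻¹ * (g * L.gen a) := by
        rw [L.gen_square hs]
        group
      have hd' : L.Descent l' ((L.gen l)⁻¹ * (g * L.gen a)) := by
        unfold Descent
        rw [e]
        omega
      have e₂ : (L.gen l)⁻¹ * (g * L.gen a) * L.gen (S.inv a) = (L.gen l)⁻¹ * g := by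
        rw [L.gen_inv]
        group
      have hlg := L.len_of_not_descent hd
      have e₃ : L.len ((L.gen l)⁻¹ * (g * L.gen a) * L.gen (S.inv a)) =
          L.len ((L.gen l)⁻¹ * (g * L.gen a)) + 1 := by
        rw [e₂, hlg, he]
      have hinv : L.Descent (S.inv l) ((L.gen l)⁻¹ * (g * L.gen a) * L.gen (S.inv a)) := by
        rw [e₂]
        unfold Descent
        rw [L.gen_inv, inv_inv, mul_inv_cancel_left, hlg]
      have hu' : ∀ b, L.Descent b ((L.gen l)⁻¹ * (g * L.gen a)) → b = l' := by
        intro b hb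
        refine (L.eq_of_three_descents hinv (hd'.mul_gen e₃) (hb.mul_gen e₃)
          (S.reduced (S.symm hs)).symm).resolve_left ?_
        rintro rfl
        unfold Descent at hb
        rw [L.gen_inv, inv_inv, mul_inv_cancel_left] at hb
        omega
      obtain rfl := ht'.unique (.single hd' hu')
      refine .inr (.inl ⟨x', by rw [e]; group, ?_, fun h => hd (hx.of_square hs h), ?_⟩)
      · rw [mul_assoc]
        unfold Descent at hx hx'
        omega
      · rw [e]
        unfold Descent at hx
        omega
    | @pair x x' y y' _ hx hy hs =>
      rcases L.eq_of_three_descents (hx.mul_gen hl) (hy.mul_gen hl) hl' (S.ne_head hs) with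
        rfl | rfl
      · exact (hd hx).elim
      · exact (hd hy).elim
  · exact .inr (.inr ⟨ht.unique .one, ht'.unique .one⟩)

/-- The relation between corresponding stages of the normal forms of `g` and `gen c * g`. -/
def LeftFellow (g g' : G) : Prop :=
  g' = g ∨ (∃ c, g' = L.gen c * g ∧ L.len g' = L.len g + 1) ∨ L.Next g' g

theorem LeftFellow.next {L : SquareLength S G} {g g' t t' : G}
    (h : L.LeftFellow g g') (ht : L.Next g t) (ht' : L.Next g' t') : L.LeftFellow t t' := by
  rcases h with rfl | ⟨c, rfl, hl⟩ | h
  · exact .inl (ht'.unique ht)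
  · have hc : L.Descent c (L.gen c * g) := by
      unfold Descent
      rw [inv_mul_cancel_left, hl]
    by_cases hu : ∀ b, L.Descent b (L.gen c * g) → b = c
    · obtain rfl := ht'.unique (.single hc hu)
      rw [inv_mul_cancel_left]
      exact .inr (.inr ht)
    · push Not at hu
      obtain ⟨x, hx, hne⟩ := hu
      obtain ⟨z, x', hs, hlen⟩ := L.exists_square hne.symm hc hx
      have e : (L.gen c * L.gen z)⁻¹ * (L.gen c * g) = (L.gen z)⁻¹ * g := by group
      obtain rfl := ht'.unique (.pair hc hx hs)
      rw [e] at hlen ⊢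
      have hz : L.Descent z g := by
        unfold Descent
        omega
      have key : ∀ {s y q}, L.Descent y g → S.Sq z s y q →
          L.LeftFellow ((L.gen z * L.gen s)⁻¹ * g) ((L.gen z)⁻¹ * g) := by
        intro s y q hy hs
        have := L.len_of_square hz hy hs
        exact .inr (.inl ⟨s, by group, by omega⟩)
      cases ht with
      | one => exact (L.not_descent_one _ hz).elim
      | single hy hu => rw [hu _ hz]; exact .inl rfl
      | @pair y s w q _ hy hw hs' =>
        rcases L.eq_of_three_descents hy hw hz (S.ne_head hs') with rfl | rfl
        · exact key hw hs'
        · rw [L.gen_square hs']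
          exact key hy (S.symm hs')
  · obtain rfl := ht'.unique h
    exact .inr (.inr ht)

/-- The remainder of `g` after one step of the greedy normal form. -/
noncomputable def next (g : G) : G := (L.exists_next g).choose

theorem next_spec (g : G) : L.Next g (L.next g) := (L.exists_next g).choose_spec

theorem next_spec_iterate (i : ℕ) (g : G) : L.Next (L.next^[i] g) (L.next^[i + 1] g) := by
  rw [Function.iterate_succ_apply']
  exact L.next_spec _

theorem exists_iterate_next_eq_one (g : G) : ∃ n, L.next^[n] g = 1 := by
  induction hn : L.len g using Nat.strong_induction_on generalizing g with
  | _ n IH =>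
    by_cases hg : g = 1
    · exact ⟨0, hg⟩
    · obtain ⟨k, hk⟩ := IH _ (hn ▸ (L.next_spec g).len_lt hg) _ rfl
      exact ⟨k + 1, hk⟩

theorem RightFellow.iterate {L : SquareLength S G} {a : A} {g g' : G}
    (h : L.RightFellow a g g') (i : ℕ) : L.RightFellow a (L.next^[i] g) (L.next^[i] g') := by
  induction i with
  | zero => exact h
  | succ i ih => exact ih.next (L.next_spec_iterate i g) (L.next_spec_iterate i g')

theorem LeftFellow.iterate {L : SquareLength S G} {g g' : G}
    (h : L.LeftFellow g g') (i : ℕ) : L.LeftFellow (L.next^[i] g) (L.next^[i] g') := by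
  induction i with
  | zero => exact h
  | succ i ih => exact ih.next (L.next_spec_iterate i g) (L.next_spec_iterate i g')

theorem RightFellow.len_le {L : SquareLength S G} {a : A} {g g' : G}
    (h : L.RightFellow a g g') : L.len (g * L.gen a * g'⁻¹) ≤ 1 := by
  rcases h with ⟨rfl, -⟩ | ⟨l, rfl, -⟩ | ⟨rfl, rfl⟩
  · rw [mul_inv_cancel, L.len_one]
    exact zero_le_one
  · rw [show g * L.gen a * ((L.gen l)⁻¹ * (g * L.gen a))⁻¹ = L.gen l by group]
    exact L.len_gen_le l
  · rw [one_mul, inv_one, mul_one]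
    exact L.len_gen_le a

theorem LeftFellow.len_le {L : SquareLength S G} {g g' : G}
    (h : L.LeftFellow g g') : L.len (g * g'⁻¹) ≤ 2 := by
  rcases h with rfl | ⟨c, rfl, -⟩ | h
  · rw [mul_inv_cancel, L.len_one]
    exact zero_le_two
  · rw [show g * (L.gen c * g)⁻¹ = (L.gen c)⁻¹ by group, L.len_inv]
    exact (L.len_gen_le c).trans one_le_two
  · exact h.len_mul_inv_le

theorem len_fellow_mul_gen (i : ℕ) (g : G) (a : A) :
    L.len (L.next^[i] g * L.gen a * (L.next^[i] (g * L.gen a))⁻¹) ≤ 1 := by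
  rcases L.len_mul_gen a g with h | h
  · exact (RightFellow.iterate (.inl ⟨rfl, h⟩) i).len_le
  · have e : g * L.gen a * L.gen (S.inv a) = g := by
      rw [L.gen_inv, mul_inv_cancel_right]
    have := (RightFellow.iterate (L := L) (a := S.inv a) (g := g * L.gen a) (g' := g)
      (.inl ⟨e.symm, h.symm⟩) i).len_le
    rw [← L.len_inv, L.gen_inv] at this
    simpa [mul_assoc] using this

theorem len_fellow_gen_mul (i : ℕ) (g : G) (a : A) :
    L.len (L.next^[i] g * (L.next^[i] (L.gen a * g))⁻¹) ≤ 2 := by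
  rcases L.len_gen_mul a g with h | h
  · exact (LeftFellow.iterate (.inr (.inl ⟨a, rfl, h⟩)) i).len_le
  · have e : g = L.gen (S.inv a) * (L.gen a * g) := by
      rw [L.gen_inv, inv_mul_cancel_left]
    have := (LeftFellow.iterate (L := L) (g := L.gen a * g) (g' := g)
      (.inr (.inl ⟨S.inv a, e, h.symm⟩)) i).len_le
    rw [← L.len_inv] at this
    simpa using this

theorem induction_len {P : G → Prop} (one : P 1)
    (gen_mul : ∀ a g, L.len (L.gen a * g) = L.len g + 1 → P g → P (L.gen a * g)) (g : G) :
    P g := by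
  induction hn : L.len g generalizing g with
  | zero => exact L.len_eq_zero.1 hn ▸ one
  | succ n ih =>
    obtain ⟨a, ha⟩ := L.exists_descent (g := g) (by
      rintro rfl
      simp [L.len_one] at hn)
    have e : L.gen a * ((L.gen a)⁻¹ * g) = g := mul_inv_cancel_left _ _
    have := gen_mul a ((L.gen a)⁻¹ * g) (by rw [e]; exact ha.symm) (ih _ (by omega))
    rwa [e] at this

theorem len_fellow_mul (i : ℕ) (w g : G) :
    L.len (L.next^[i] g * w * (L.next^[i] (g * w))⁻¹) ≤ L.len w := by
  induction w using L.induction_len generalizing g with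
  | one => simp [L.len_one]
  | gen_mul a w h ih =>
    have h₁ := L.len_fellow_mul_gen i g a
    have h₂ := ih (g * L.gen a)
    have h₃ := L.len_mul_le (L.next^[i] g * L.gen a * (L.next^[i] (g * L.gen a))⁻¹)
      (L.next^[i] (g * L.gen a) * w * (L.next^[i] (g * L.gen a * w))⁻¹)
    simp only [mul_assoc, inv_mul_cancel_left] at h₁ h₂ h₃ ⊢
    omega

theorem len_fellow_left_mul (i : ℕ) (u g : G) :
    L.len (L.next^[i] g * (L.next^[i] (u * g))⁻¹) ≤ 2 * L.len u := by
  induction u using L.induction_len with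
  | one => simp [L.len_one]
  | gen_mul a u h ih =>
    have h₁ := L.len_fellow_gen_mul i (u * g) a
    have h₃ := L.len_mul_le (L.next^[i] g * (L.next^[i] (u * g))⁻¹)
      (L.next^[i] (u * g) * (L.next^[i] (L.gen a * (u * g)))⁻¹)
    simp only [mul_assoc, inv_mul_cancel_left] at h₁ h₃ ⊢
    omega

/-- Conjugation by a letter inside the ball of radius `N`. -/
def ConjStep (N : ℕ) (p q : G) : Prop :=
  ∃ a, q = (L.gen a)⁻¹ * p * L.gen a ∧ L.len p ≤ N ∧ L.len q ≤ N

theorem Next.conjStep {L : SquareLength S G} {N : ℕ} {g t w : G} (h : L.Next g t)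
    (hg : L.len (g * w * g⁻¹) ≤ N) (ht : L.len (t * w * t⁻¹) ≤ N) :
    Relation.ReflTransGen (L.ConjStep (N + 2)) (g * w * g⁻¹) (t * w * t⁻¹) := by
  cases h with
  | one => exact .refl
  | @single a => exact .single ⟨a, by group, by omega, by omega⟩
  | @pair x x' =>
    have e : (L.gen x)⁻¹ * (g * w * g⁻¹) * L.gen x =
      (L.gen x)⁻¹ * ((g * w * g⁻¹) * L.gen x) := mul_assoc _ _ _
    have h₁ := L.len_mul_le (L.gen x)⁻¹ ((g * w * g⁻¹) * L.gen x)
    have h₂ := L.len_mul_le (g * w * g⁻¹) (L.gen x)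
    have h₃ := L.len_gen_le x
    rw [L.len_inv] at h₁
    have h₄ : L.len ((L.gen x)⁻¹ * (g * w * g⁻¹) * L.gen x) ≤ N + 2 := by
      rw [e]
      omega
    refine .tail (.single ⟨x, rfl, by omega, h₄⟩) ⟨x', by group, h₄, by omega⟩

/-- Conjugate elements are joined by conjugations by letters through elements of bounded length. -/
theorem conjStep_of_conj (g w : G) :
    Relation.ReflTransGen (L.ConjStep (2 * L.len (g * w * g⁻¹) + L.len w + 2))
      (g * w * g⁻¹) w := by
  have hb : ∀ i, L.len (L.next^[i] g * w * (L.next^[i] g)⁻¹) ≤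
      2 * L.len (g * w * g⁻¹) + L.len w := by
    intro i
    have h₁ := L.len_fellow_mul i w g
    have h₂ := L.len_fellow_left_mul i (g * w * g⁻¹) g
    rw [inv_mul_cancel_right, ← L.len_inv, mul_inv_rev, inv_inv] at h₂
    have h₃ := L.len_mul_le (L.next^[i] g * w * (L.next^[i] (g * w))⁻¹)
      (L.next^[i] (g * w) * (L.next^[i] g)⁻¹)
    simp only [mul_assoc, inv_mul_cancel_left] at h₁ h₂ h₃ ⊢
    omega
  have hr : ∀ i, Relation.ReflTransGen (L.ConjStep (2 * L.len (g * w * g⁻¹) + L.len w + 2))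
      (g * w * g⁻¹) (L.next^[i] g * w * (L.next^[i] g)⁻¹) := by
    intro i
    induction i with
    | zero => exact .refl
    | succ i ih => exact ih.trans ((L.next_spec_iterate i g).conjStep (hb i) (hb (i + 1)))
  obtain ⟨n, hn⟩ := L.exists_iterate_next_eq_one g
  simpa [hn] using hr n

end SquareLength

/-- A group generated by the letters of a square system, subject exactly to the relations given
by the squares: it acts on the irreducible classes through the letter permutations. -/
structure SquareModel {A : Type*} (S : SquareSystem A) (G : Type*) [Group G] where
  gen : A → G
  gen_inv : ∀ a, gen (S.inv a) = (gen a)⁻¹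
  gen_square : ∀ {x x' y y'}, S.Sq x x' y y' → gen x * gen x' = gen y * gen y'
  exists_word : ∀ g, ∃ w : List A, (w.map gen).prod = g
  rho : G →* Equiv.Perm S.Irred
  rho_gen : ∀ a, rho (gen a) = S.perm a

namespace SquareModel

variable {A : Type*} {S : SquareSystem A} {G : Type*} [Group G] (M : SquareModel S G)

/-- The element represented by a word. -/
def val (w : List A) : G := (w.map M.gen).prod

theorem val_nil : M.val [] = 1 := rfl

theorem val_cons (a : A) (w : List A) : M.val (a :: w) = M.gen a * M.val w := by simp [val]

theorem val_append (v w : List A) : M.val (v ++ w) = M.val v * M.val w := by simp [val]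

theorem val_exchange {v w : List A} (h : S.Exchange v w) : M.val v = M.val w := by
  induction h with
  | head w h => simp only [val_cons, ← mul_assoc, M.gen_square h]
  | cons x _ ih => rw [val_cons, val_cons, ih]

/-- The element represented by a class. -/
def eval : S.Cls → G :=
  Quotient.lift M.val fun _ _ (h : S.ExEquiv _ _) => by
    induction h with
    | refl => rfl
    | tail _ h ih => exact ih.trans (M.val_exchange h)

theorem eval_cls (w : List A) : M.eval (S.cls w) = M.val w := rfl

theorem eval_cons (a : A) (p : S.Cls) : M.eval (S.cons a p) = M.gen a * M.eval p := by
  obtain ⟨w, rfl⟩ := S.exists_cls p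
  exact M.val_cons a w

theorem eval_act (a : A) (p : S.Cls) : M.eval (S.act a p) = M.gen a * M.eval p := by
  by_cases h : ∃ q, p = S.cons (S.inv a) q
  · obtain ⟨q, rfl⟩ := h
    rw [S.act_cons_inv, eval_cons, M.gen_inv, mul_inv_cancel_left]
  · rw [S.act_of_not h, eval_cons]

/-- The irreducible class representing a group element. -/
noncomputable def irr (g : G) : S.Cls := (M.rho g ⟨S.cls [], S.not_reducible_nil⟩).1

theorem irr_one : M.irr 1 = S.cls [] := by
  rw [irr, map_one]
  rfl

theorem irr_gen_mul (a : A) (g : G) : M.irr (M.gen a * g) = S.act a (M.irr g) := by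
  rw [irr, map_mul, M.rho_gen]
  rfl

theorem irr_gen_inv_mul (a : A) (g : G) :
    M.irr ((M.gen a)⁻¹ * g) = S.act (S.inv a) (M.irr g) := by
  rw [← M.gen_inv, irr_gen_mul]

theorem eval_irr (g : G) : M.eval (M.irr g) = g := by
  obtain ⟨w, rfl⟩ := M.exists_word g
  induction w with
  | nil =>
    rw [List.map_nil, List.prod_nil, irr_one]
    rfl
  | cons a w ih => rw [List.map_cons, List.prod_cons, irr_gen_mul, eval_act, ih]

theorem length_act (a : A) (p : S.Cls) :
    S.length (S.act a p) = S.length p + 1 ∨ S.length (S.act a p) + 1 = S.length p := by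
  by_cases h : ∃ q, p = S.cons (S.inv a) q
  · obtain ⟨q, rfl⟩ := h
    rw [S.act_cons_inv, S.length_cons]
    exact .inr rfl
  · rw [S.act_of_not h, S.length_cons]
    exact .inl rfl

theorem length_irr_val_le (w : List A) : S.length (M.irr (M.val w)) ≤ w.length := by
  induction w with
  | nil => rw [val_nil, irr_one, S.length_cls]
  | cons a w ih =>
    rw [val_cons, irr_gen_mul, List.length_cons]
    have := length_act a (M.irr (M.val w))
    omega

theorem exists_shortest_word (g : G) :
    ∃ w, M.val w = g ∧ w.length = S.length (M.irr g) := by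
  obtain ⟨w, hw⟩ := S.exists_cls (M.irr g)
  refine ⟨w, ?_, ?_⟩
  · rw [← eval_cls, ← hw, eval_irr]
  · rw [hw, S.length_cls]

theorem val_reverse_inv (w : List A) : M.val (w.map S.inv).reverse = (M.val w)⁻¹ := by
  induction w with
  | nil => simp [val_nil]
  | cons a w ih => simp [val_append, val_cons, val_nil, ih, M.gen_inv]

theorem length_irr_inv_le (g : G) : S.length (M.irr g⁻¹) ≤ S.length (M.irr g) := by
  obtain ⟨w, rfl, hw⟩ := M.exists_shortest_word g
  rw [← val_reverse_inv, ← hw]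
  simpa using M.length_irr_val_le (w.map S.inv).reverse

theorem irr_eq_cons_of_descent {a : A} {g : G}
    (h : S.length (M.irr ((M.gen a)⁻¹ * g)) + 1 = S.length (M.irr g)) :
    M.irr g = S.cons a (M.irr ((M.gen a)⁻¹ * g)) := by
  rw [irr_gen_inv_mul] at h ⊢
  by_cases h' : ∃ q, M.irr g = S.cons (S.inv (S.inv a)) q
  · obtain ⟨q, hq⟩ := h'
    rw [hq, S.act_cons_inv, S.inv_inv]
  · rw [S.act_of_not h', S.length_cons] at h
    omega

theorem descent_of_irr_eq_cons {a : A} {g : G} {q : S.Cls} (h : M.irr g = S.cons a q) :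
    M.irr ((M.gen a)⁻¹ * g) = q := by
  rw [irr_gen_inv_mul, h, S.act_inv_cons]

/-- The word length of a square model. -/
noncomputable def toLength : SquareLength S G where
  gen := M.gen
  len g := S.length (M.irr g)
  gen_inv := M.gen_inv
  gen_square := M.gen_square
  len_eq_zero {g} := by
    constructor
    · intro h
      rw [← M.eval_irr g]
      rcases S.eq_nil_or_cons (M.irr g) with h' | ⟨a, q, h'⟩
      · rw [h']
        rfl
      · rw [h', S.length_cons] at h
        omega
    · rintro rfl
      rw [irr_one, S.length_cls, List.length_nil]
  len_gen_mul a g := by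
    rw [irr_gen_mul]
    exact length_act a _
  len_inv g := by
    refine le_antisymm (M.length_irr_inv_le g) ?_
    have := M.length_irr_inv_le g⁻¹
    rwa [inv_inv] at this
  len_mul_le g h := by
    obtain ⟨v, rfl, hv⟩ := M.exists_shortest_word g
    obtain ⟨w, rfl, hw⟩ := M.exists_shortest_word h
    rw [← val_append, ← hv, ← hw, ← List.length_append]
    exact M.length_irr_val_le _
  exists_descent {g} hg := by
    rcases S.eq_nil_or_cons (M.irr g) with h | ⟨a, q, h⟩
    · refine (hg ?_).elim
      rw [← M.eval_irr g, h]
      rfl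
    · refine ⟨a, ?_⟩
      rw [M.descent_of_irr_eq_cons h, h, S.length_cons]
  exists_square {x y g} hxy hx hy := by
    have h₁ := M.irr_eq_cons_of_descent hx
    have h₂ := M.irr_eq_cons_of_descent hy
    rcases S.cons_eq_cons (h₁.symm.trans h₂) with ⟨h, -⟩ | ⟨x', y', r, hr, -, hs⟩
    · exact (hxy h).elim
    · refine ⟨x', y', hs, ?_⟩
      rw [mul_inv_rev, mul_assoc, M.descent_of_irr_eq_cons hr, h₁, S.length_cons, hr,
        S.length_cons]

theorem len_val_le (w : List A) : M.toLength.len (M.val w) ≤ w.length := M.length_irr_val_le w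

end SquareModel

namespace SquareSystem

variable {A : Type*} (S : SquareSystem A)

/-- Elementary moves on cyclic words. -/
inductive CycStep : List A → List A → Prop
  | rotate (a : A) (t : List A) : CycStep (a :: t) (t ++ [a])
  | exchange {x x' y y' : A} (t : List A) : S.Sq x x' y y' →
      CycStep (x :: x' :: t) (y :: y' :: t)
  | cancel (a : A) (t : List A) : CycStep (a :: S.inv a :: t) t
  | insert (a : A) (t : List A) : CycStep t (a :: S.inv a :: t)

/-- Elementary moves between cyclic words of length at most `N`. -/
def BoundedStep (N : ℕ) (v w : List A) : Prop := S.CycStep v w ∧ v.length ≤ N ∧ w.length ≤ N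

/-- Connectedness by elementary moves through words of length at most `N`. -/
abbrev Conn (N : ℕ) : List A → List A → Prop := Relation.ReflTransGen (S.BoundedStep N)

theorem conn_append_comm {N : ℕ} (v w : List A) (h : (v ++ w).length ≤ N) :
    S.Conn N (v ++ w) (w ++ v) := by
  induction v generalizing w with
  | nil =>
    rw [List.append_nil]
    exact .refl
  | cons a v ih =>
    have e : w ++ a :: v = (w ++ [a]) ++ v := by simp
    rw [e]
    refine .head ⟨.rotate a (v ++ w), h, ?_⟩ ?_
    · simp at h ⊢
      omega
    · rw [List.append_assoc]
      exact ih _ (by simp at h ⊢; omega)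

theorem conn_symm {N : ℕ} {v w : List A} (h : S.Conn N v w) : S.Conn N w v := by
  induction h with
  | refl => exact .refl
  | tail _ h ih =>
    refine .trans ?_ ih
    obtain ⟨h, h₁, h₂⟩ := h
    cases h with
    | rotate a t => exact S.conn_append_comm t [a] h₂
    | exchange t h => exact .single ⟨.exchange t (S.symm h), h₂, h₁⟩
    | cancel a t => exact .single ⟨.insert a _, h₂, h₁⟩
    | insert a t => exact .single ⟨.cancel a _, h₂, h₁⟩

theorem conn_append_of_cycStep {N : ℕ} {v w : List A} (p : List A)
    (h : ∀ t, S.CycStep (v ++ t) (w ++ t)) (hv : (p ++ v).length ≤ N)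
    (hw : (p ++ w).length ≤ N) : S.Conn N (p ++ v) (p ++ w) := by
  have e : ∀ u : List A, (u ++ p).length = (p ++ u).length := fun u => by simp [add_comm]
  exact ((S.conn_append_comm p v hv).tail ⟨h p, by rwa [e], by rwa [e]⟩).trans
    (S.conn_append_comm w p (by rwa [e]))

theorem conn_of_exchange {N : ℕ} {v w : List A} (p : List A) (h : S.Exchange v w)
    (hv : (p ++ v).length ≤ N) : S.Conn N (p ++ v) (p ++ w) := by
  induction h generalizing p with
  | head w h =>
    refine S.conn_append_of_cycStep p (fun t => ?_) hv (by simpa using hv)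
    exact .exchange _ h
  | cons x _ ih =>
    have := ih (p ++ [x]) (by simpa using hv)
    simpa using this

theorem conn_of_exEquiv {N : ℕ} {v w : List A} (p : List A) (h : S.ExEquiv v w)
    (hv : (p ++ v).length ≤ N) : S.Conn N (p ++ v) (p ++ w) := by
  induction h with
  | refl => exact .refl
  | tail h₁ h₂ ih =>
    refine ih.trans (S.conn_of_exchange p h₂ ?_)
    rw [List.length_append, ← ExEquiv.length_eq S h₁, ← List.length_append]
    exact hv

theorem conn_of_cls_eq {N : ℕ} {v w : List A} (p : List A) (h : S.cls v = S.cls w)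
    (hv : (p ++ v).length ≤ N) : S.Conn N (p ++ v) (p ++ w) :=
  S.conn_of_exEquiv p (Quotient.exact (s := S.setoid) h) hv

end SquareSystem

namespace SquareModel

variable {A : Type*} {S : SquareSystem A} {G : Type*} [Group G] (M : SquareModel S G)

theorem isConj_of_cycStep {v w : List A} (h : S.CycStep v w) : IsConj (M.val v) (M.val w) := by
  cases h with
  | rotate a t =>
    rw [val_cons, val_append, val_cons, val_nil, mul_one]
    exact isConj_iff.2 ⟨(M.gen a)⁻¹, by group⟩
  | exchange t h =>
    simp only [val_cons, ← mul_assoc, M.gen_square h]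
    exact IsConj.refl _
  | cancel a t =>
    rw [val_cons, val_cons, M.gen_inv, mul_inv_cancel_left]
  | insert a t =>
    rw [val_cons, val_cons, M.gen_inv, mul_inv_cancel_left]

theorem isConj_of_conn {N : ℕ} {v w : List A} (h : S.Conn N v w) :
    IsConj (M.val v) (M.val w) := by
  induction h with
  | refl => exact IsConj.refl _
  | tail _ h ih => exact ih.trans (M.isConj_of_cycStep h.1)

theorem exists_conn_irr (v : List A) : ∃ w, S.cls w = M.irr (M.val v) ∧ w.length ≤ v.length ∧
    ∀ N p, (p ++ v).length ≤ N → S.Conn N (p ++ v) (p ++ w) := by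
  induction v with
  | nil => exact ⟨[], (M.irr_one).symm, le_rfl, fun _ _ _ => .refl⟩
  | cons a v ih =>
    obtain ⟨w, hw, hl, h⟩ := ih
    rw [val_cons, irr_gen_mul, ← hw]
    have h₁ : ∀ N p, (p ++ a :: v).length ≤ N → S.Conn N (p ++ a :: v) (p ++ a :: w) := by
      intro N p hp
      simpa using h N (p ++ [a]) (by simpa using hp)
    by_cases hd : ∃ q, S.cls w = S.cons (S.inv a) q
    · obtain ⟨q, hq⟩ := hd
      rw [hq, S.act_cons_inv]
      obtain ⟨t, rfl⟩ := S.exists_cls q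
      have hlen := congrArg S.length hq
      rw [S.length_cls, S.length_cons, S.length_cls] at hlen
      refine ⟨t, rfl, by simp only [List.length_cons]; omega, fun N p hp => ?_⟩
      have hN : p.length + (v.length + 1) ≤ N := by simpa using hp
      have h₂ : S.Conn N (p ++ a :: w) (p ++ a :: S.inv a :: t) := by
        simpa using S.conn_of_cls_eq (N := N) (p ++ [a]) (w := S.inv a :: t) hq
          (by simp; omega)
      refine ((h₁ N p hp).trans h₂).trans ?_
      have h₃ := S.conn_append_comm p (a :: S.inv a :: t) (N := N) (by simp; omega)
      refine (h₃.tail ⟨.cancel a (t ++ p), by simp; omega, by simp; omega⟩).trans ?_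
      exact S.conn_append_comm t p (by simp; omega)
    · rw [S.act_of_not hd]
      exact ⟨a :: w, rfl, by simpa using hl, h₁⟩

theorem conn_of_conjStep {N : ℕ} {p q : G} {v w : List A} (h : M.toLength.ConjStep N p q)
    (hv : S.cls v = M.irr p) (hw : S.cls w = M.irr q) : S.Conn (N + 2) v w := by
  obtain ⟨a, rfl, h₁, -⟩ := h
  have hp : M.val v = p := by rw [← eval_cls, hv, eval_irr]
  have hl : v.length ≤ N := by
    rw [← S.length_cls, hv]
    exact h₁
  have e : M.val (S.inv a :: v ++ [a]) = (M.gen a)⁻¹ * p * M.gen a := by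
    rw [val_append, val_cons, val_cons, val_nil, mul_one, hp, M.gen_inv]
  obtain ⟨w', hw', hl', hc⟩ := M.exists_conn_irr (S.inv a :: v ++ [a])
  refine .head ⟨.insert a v, by omega, by simpa using hl⟩ ?_
  refine .head ⟨.rotate a (S.inv a :: v), by simpa using hl, by simpa using hl⟩ ?_
  refine (hc (N + 2) [] (by simpa using hl)).trans ?_
  refine S.conn_of_cls_eq [] ?_ (by simp at hl' ⊢; omega)
  rw [hw', hw, e]
  rfl

theorem conn_of_isConj {u w : List A} (h : IsConj (M.val u) (M.val w)) :
    S.Conn (2 * u.length + w.length + 4) u w := by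
  obtain ⟨c, hc⟩ := isConj_iff.1 h.symm
  have hr := M.toLength.conjStep_of_conj c (M.val w)
  rw [hc] at hr
  set N := 2 * M.toLength.len (M.val u) + M.toLength.len (M.val w) + 2
  have hN : N ≤ 2 * u.length + w.length + 2 := by
    have := M.len_val_le u
    have := M.len_val_le w
    omega
  have key : ∀ {p}, Relation.ReflTransGen (M.toLength.ConjStep N) (M.val u) p → ∀ v,
      S.cls v = M.irr p → S.Conn (2 * u.length + w.length + 4) u v := by
    intro p hp
    induction hp with
    | refl =>
      intro v hv
      obtain ⟨v', hv', hl, h⟩ := M.exists_conn_irr u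
      refine (h _ [] (by simp; omega)).trans ?_
      exact S.conn_of_cls_eq [] (hv'.trans hv.symm) (by simp; omega)
    | @tail q r _ hs ih =>
      intro v hv
      obtain ⟨t, ht⟩ := S.exists_cls (M.irr q)
      obtain ⟨a, ha, h₁, h₂⟩ := hs
      have hs' : M.toLength.ConjStep (2 * u.length + w.length + 2) q r :=
        ⟨a, ha, by omega, by omega⟩
      exact (ih t ht.symm).trans (M.conn_of_conjStep hs' ht.symm hv)
  obtain ⟨v, hv, -, h⟩ := M.exists_conn_irr w
  exact (key hr v hv).trans (S.conn_symm (h _ [] (by simp; omega)))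

theorem isConj_iff_conn (u w : List A) :
    IsConj (M.val u) (M.val w) ↔ S.Conn (2 * u.length + w.length + 4) u w :=
  ⟨M.conn_of_isConj, M.isConj_of_conn⟩

end SquareModel

theorem letterInv_letterInv {X : Type*} (a : X × Bool) : letterInv (letterInv a) = a := by
  simp [letterInv]

theorem letterInv_injective {X : Type*} : Function.Injective (letterInv (X := X)) :=
  Function.LeftInverse.injective letterInv_letterInv

theorem letterInv_ne {X : Type*} (a : X × Bool) : letterInv a ≠ a := by
  intro h
  simpa [letterInv] using congrArg Prod.snd h

theorem eq_or_eq_letterInv {X : Type*} {l e : X × Bool} (h : l.1 = e.1) : l = e ∨ l = letterInv e := by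
  obtain ⟨x, b⟩ := l
  obtain ⟨y, c⟩ := e
  obtain rfl : x = y := h
  cases b <;> cases c <;> simp [letterInv]

section PresentedWords

variable {X : Type*} {R : Set (FreeGroup X)}

theorem toG_append (v w : Word X) : toG R (v ++ w) = toG R v * toG R w := by
  rw [toG, ← FreeGroup.mul_mk, map_mul]
  rfl

theorem toG_cons (a : X × Bool) (w : Word X) : toG R (a :: w) = toG R [a] * toG R w :=
  toG_append [a] w

theorem toG_letterInv (a : X × Bool) : toG R [letterInv a] = (toG R [a])⁻¹ := by
  rw [toG, toG, ← map_inv, FreeGroup.inv_mk]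
  rfl

theorem toG_invRev (t : Word X) :
    toG R (FreeGroup.invRev t) = (toG R t)⁻¹ := by
  rw [toG, toG, ← FreeGroup.inv_mk, map_inv]

theorem toG_relator {w : Word X} (h : FreeGroup.mk w ∈ R) : toG R w = 1 :=
  PresentedGroup.one_of_mem h

theorem exists_toG (g : PresentedGroup R) : ∃ w, toG R w = g := by
  obtain ⟨x, rfl⟩ := PresentedGroup.mk_surjective R g
  obtain ⟨w, rfl⟩ := Quot.exists_rep x
  exact ⟨w, rfl⟩

theorem toG_eq_prod (w : Word X) : (w.map fun a => toG R [a]).prod = toG R w := by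
  induction w with
  | nil => exact (map_one _).symm
  | cons a w ih => rw [List.map_cons, List.prod_cons, ih, ← toG_cons]

theorem SquareSystem.perm_sign (S : SquareSystem (X × Bool)) (hinv : S.inv = letterInv)
    (a : X × Bool) :
    (FreeGroup.lift fun x => S.perm (x, true)) (FreeGroup.mk [a]) = S.perm a := by
  obtain ⟨x, b⟩ := a
  cases b with
  | true => simp
  | false =>
    have : S.perm (x, false) = (S.perm (x, true))⁻¹ := by
      rw [← S.perm_inv, hinv]
      rfl
    simp [this]

end PresentedWords

section Relators

variable {X : Type*} [DecidableEq X] {R : Set (FreeGroup X)}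

theorem toWord_mk_of_mem (hC : Cpp4 R) {L : Word X} (h : FreeGroup.mk L ∈ R)
    (hL : L.length = 4) : (FreeGroup.mk L).toWord = L := by
  have h4 := hC.1 _ h
  rw [FreeGroup.toWord_mk] at h4 ⊢
  exact (FreeGroup.Red.sublist FreeGroup.reduce.red).eq_of_length (h4.trans hL.symm)

theorem exists_letters_of_mem (hC : Cpp4 R) {r : FreeGroup X} (h : r ∈ R) :
    ∃ a b c d, r = FreeGroup.mk [a, b, c, d] ∧ r.toWord = [a, b, c, d] := by
  have h4 := hC.1 _ h
  obtain ⟨a, b, c, d, e⟩ := List.length_eq_four.1 h4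
  exact ⟨a, b, c, d, by rw [← e, FreeGroup.mk_toWord], e⟩

theorem relator_ext (hC : Cpp4 R) {a b c d a' b' c' d' : X × Bool}
    (h : FreeGroup.mk [a, b, c, d] ∈ R) (h' : FreeGroup.mk [a', b', c', d'] ∈ R)
    (e : FreeGroup.mk [a, b, c, d] = FreeGroup.mk [a', b', c', d']) :
    a = a' ∧ b = b' ∧ c = c' ∧ d = d' := by
  have := toWord_mk_of_mem hC h rfl
  rw [e, toWord_mk_of_mem hC h' rfl] at this
  simpa [eq_comm] using this

theorem relator_rotate (hS : Symmetrized R) (hC : Cpp4 R) {a b c d : X × Bool}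
    (h : FreeGroup.mk [a, b, c, d] ∈ R) : FreeGroup.mk [b, c, d, a] ∈ R :=
  hS.2.2 _ h a [b, c, d] (toWord_mk_of_mem hC h rfl)

theorem relator_inv (hS : Symmetrized R) {a b c d : X × Bool}
    (h : FreeGroup.mk [a, b, c, d] ∈ R) :
    FreeGroup.mk [letterInv d, letterInv c, letterInv b, letterInv a] ∈ R := by
  have := hS.2.1 _ h
  rwa [FreeGroup.inv_mk] at this

theorem relator_reduced (hS : Symmetrized R) (hC : Cpp4 R) {a b c d : X × Bool}
    (h : FreeGroup.mk [a, b, c, d] ∈ R) : b ≠ letterInv a := by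
  have := (hS.1 _ h).1
  rw [toWord_mk_of_mem hC h rfl] at this
  exact (List.isChain_cons_cons.1 this).1

theorem relator_cyclically_reduced (hS : Symmetrized R) (hC : Cpp4 R) {a b c d : X × Bool}
    (h : FreeGroup.mk [a, b, c, d] ∈ R) : d ≠ letterInv a := by
  rintro rfl
  refine (hS.1 _ h).2 ⟨a, [b, c], ?_⟩
  rw [toWord_mk_of_mem hC h rfl]
  rfl

theorem relator_mk_mul (hC : Cpp4 R) {a b c d b' c' d' : X × Bool}
    (h : FreeGroup.mk [a, b, c, d] ∈ R) (h' : FreeGroup.mk [letterInv d, b', c', d'] ∈ R) :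
    ¬ NoCancel (FreeGroup.mk [a, b, c, d]) (FreeGroup.mk [letterInv d, b', c', d']) := by
  intro hn
  rw [NoCancel, toWord_mk_of_mem hC h rfl, toWord_mk_of_mem hC h' rfl] at hn
  have h₁ : FreeGroup.mk [a, b, c, d] * FreeGroup.mk [letterInv d, b', c', d'] =
      FreeGroup.mk [a, b, c, b', c', d'] := by
    rw [FreeGroup.mul_mk]
    exact Quot.sound (FreeGroup.Red.Step.not (L₁ := [a, b, c]) (x := d.1) (b := d.2))
  rw [h₁, FreeGroup.toWord_mk] at hn
  have := (FreeGroup.Red.sublist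
    (FreeGroup.reduce.red (L := [a, b, c, b', c', d']))).length_le
  rw [hn] at this
  simp at this

/-- The square system of a symmetrized presentation without two-letter pieces. -/
def squareSystem (hS : Symmetrized R) (hC : Cpp4 R) (hT : T4 R)
    (hP : ∀ a b, ¬ IsPiece R [a, b]) : SquareSystem (X × Bool) where
  inv := letterInv
  inv_inv := letterInv_letterInv
  Sq x x' y y' := FreeGroup.mk [x, x', letterInv y', letterInv y] ∈ R
  symm h := by simpa only [letterInv_letterInv] using relator_inv hS h
  turn h := by
    have h₁ := relator_inv hS h
    have h₂ := relator_rotate hS hC (relator_rotate hS hC (relator_rotate hS hC h₁))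
    simpa only [letterInv_letterInv] using h₂
  unique {x x' y y' z z'} h h' := by
    by_contra hne
    refine hP x x' ⟨by simp, _, h, _, h', fun e => hne ?_, ⟨_, toWord_mk_of_mem hC h rfl⟩,
      ⟨_, toWord_mk_of_mem hC h' rfl⟩⟩
    obtain ⟨-, -, h₁, h₂⟩ := relator_ext hC h h' e
    exact ⟨letterInv_injective h₂, letterInv_injective h₁⟩
  reduced h := relator_reduced hS hC h
  no_triangle {x y z x₁ y₁ y₂ z₁ x₂ z₂} h₁ h₂ h := by
    have h₃ := relator_inv hS h
    rw [letterInv_letterInv, letterInv_letterInv] at h₃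
    have hxy : y ≠ x := fun e => relator_cyclically_reduced hS hC h₁ (by rw [e])
    have hyz : z ≠ y := fun e => relator_cyclically_reduced hS hC h₂ (by rw [e])
    have hxz : x ≠ z := fun e => relator_cyclically_reduced hS hC h₃ (by rw [e])
    have key : ∀ {a b c d b' c' d' : X × Bool},
        FreeGroup.mk [a, b, c, letterInv d] ∈ R → FreeGroup.mk [d, b', c', letterInv d'] ∈ R →
        a ≠ d' → FreeGroup.mk [a, b, c, letterInv d] ≠
          (FreeGroup.mk [d, b', c', letterInv d'])⁻¹ ∧
        ¬ NoCancel (FreeGroup.mk [a, b, c, letterInv d])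
          (FreeGroup.mk [d, b', c', letterInv d']) := by
      intro a b c d b' c' d' h h' hne
      refine ⟨fun e => hne ?_, ?_⟩
      · rw [FreeGroup.inv_mk] at e
        have h'' := relator_inv hS h'
        rw [letterInv_letterInv] at h''
        refine (relator_ext hC h h'' (e.trans ?_)).1
        simp [FreeGroup.invRev, letterInv]
      · have := relator_mk_mul hC h (by rwa [letterInv_letterInv])
        rwa [letterInv_letterInv] at this
    obtain ⟨n₁, c₁⟩ := key h₁ h₂ hxz
    obtain ⟨n₂, c₂⟩ := key h₂ h₃ hxy
    obtain ⟨n₃, c₃⟩ := key h₃ h₁ hyz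
    rcases hT _ h₁ _ h₂ _ h₃ n₁ n₂ (fun e => n₃ (by rw [e, inv_inv])) with h | h | h
    · exact c₁ h
    · exact c₂ h
    · exact c₃ h

/-- The presented group is a model of its square system. -/
noncomputable def squareModel (hS : Symmetrized R) (hC : Cpp4 R) (hT : T4 R)
    (hP : ∀ a b, ¬ IsPiece R [a, b]) :
    SquareModel (squareSystem hS hC hT hP) (PresentedGroup R) where
  gen a := toG R [a]
  gen_inv := toG_letterInv
  gen_square {x x' y y'} h := by
    rw [← mul_inv_eq_one, mul_inv_rev, mul_assoc, ← toG_letterInv, ← toG_letterInv, ← toG_append,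
      ← toG_append, ← toG_append]
    exact toG_relator h
  exists_word g := by
    obtain ⟨w, rfl⟩ := exists_toG g
    exact ⟨w, toG_eq_prod w⟩
  rho := PresentedGroup.toGroup (f := fun x => (squareSystem hS hC hT hP).perm (x, true)) <| by
    intro r hr
    obtain ⟨a, b, c, d, rfl, -⟩ := exists_letters_of_mem hC hr
    set S := squareSystem hS hC hT hP
    have h : S.perm a * S.perm b = S.perm (letterInv d) * S.perm (letterInv c) := by
      refine S.perm_square ?_
      change FreeGroup.mk [a, b, letterInv (letterInv c), letterInv (letterInv d)] ∈ R
      rwa [letterInv_letterInv, letterInv_letterInv]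
    have e : FreeGroup.mk [a, b, c, d] = FreeGroup.mk [a] * FreeGroup.mk [b] *
        FreeGroup.mk [c] * FreeGroup.mk [d] := by
      simp only [FreeGroup.mul_mk, List.cons_append, List.nil_append]
    rw [e, map_mul, map_mul, map_mul]
    simp only [S.perm_sign rfl]
    rw [h]
    have hi : ∀ a, S.perm (letterInv a) = (S.perm a)⁻¹ := S.perm_inv
    rw [hi, hi]
    group
  rho_gen a := SquareSystem.perm_sign _ rfl a

theorem val_squareModel (hS : Symmetrized R) (hC : Cpp4 R) (hT : T4 R)
    (hP : ∀ a b, ¬ IsPiece R [a, b]) (w : Word X) :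
    (squareModel hS hC hT hP).val w = toG R w := toG_eq_prod w

theorem isConj_toG_iff (hS : Symmetrized R) (hC : Cpp4 R) (hT : T4 R)
    (hP : ∀ a b, ¬ IsPiece R [a, b]) (u w : Word X) :
    IsConj (toG R u) (toG R w) ↔
      (squareSystem hS hC hT hP).Conn (2 * u.length + w.length + 4) u w := by
  rw [← val_squareModel hS hC hT hP u, ← val_squareModel hS hC hT hP w]
  exact (squareModel hS hC hT hP).isConj_iff_conn u w

end Relators

section Elimination

variable {X : Type*} [DecidableEq X]

/-- The relators in which a generator does not occur. -/
def relatorsAvoiding (R : Set (FreeGroup X)) (x : X) : Set (FreeGroup X) :=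
  {r ∈ R | ∀ l ∈ r.toWord, l.1 ≠ x}

/-- The substitution solving the relator `e t` for the letter `e`. -/
def eliminate (e : X × Bool) (t : Word X) (l : X × Bool) : Word X :=
  if l = e then FreeGroup.invRev t else if l = letterInv e then t else [l]

theorem IsPiece.mono {R R' : Set (FreeGroup X)} (h : R' ⊆ R) {p : Word X} (hp : IsPiece R' p) :
    IsPiece R p := by
  obtain ⟨h₀, r, hr, s, hs, h'⟩ := hp
  exact ⟨h₀, r, h hr, s, h hs, h'⟩

theorem Cpp4.mono {R R' : Set (FreeGroup X)} (h : R' ⊆ R) (hC : Cpp4 R) : Cpp4 R' :=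
  ⟨fun r hr => hC.1 r (h hr), fun r hr ⟨ps, h₁, h₂, h₃⟩ =>
    hC.2 r (h hr) ⟨ps, h₁, fun p hp => (h₂ p hp).mono h, h₃⟩⟩

theorem T4.mono {R R' : Set (FreeGroup X)} (h : R' ⊆ R) (hT : T4 R) : T4 R' :=
  fun r₁ h₁ r₂ h₂ r₃ h₃ => hT r₁ (h h₁) r₂ (h h₂) r₃ (h h₃)

variable {R : Set (FreeGroup X)}

theorem relatorsAvoiding_subset (x : X) : relatorsAvoiding R x ⊆ R := fun _ h => h.1

theorem symmetrized_relatorsAvoiding (hS : Symmetrized R) (hC : Cpp4 R) (x : X) :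
    Symmetrized (relatorsAvoiding R x) := by
  refine ⟨fun r hr => hS.1 r hr.1, fun r hr => ⟨hS.2.1 r hr.1, fun l hl => ?_⟩,
    fun r hr a t e => ?_⟩
  · rw [FreeGroup.toWord_inv] at hl
    simp only [FreeGroup.invRev, List.mem_reverse, List.mem_map] at hl
    obtain ⟨l', hl', rfl⟩ := hl
    exact hr.2 l' hl'
  · have h := hS.2.2 r hr.1 a t e
    refine ⟨h, fun l hl => ?_⟩
    have h4 := hC.1 r hr.1
    rw [e, List.length_cons] at h4
    rw [toWord_mk_of_mem hC h (by simpa using h4)] at hl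
    refine hr.2 l ?_
    rw [e]
    simpa [or_comm] using hl

theorem toG_eliminate_letterInv (e : X × Bool) (t : Word X) (l : X × Bool) :
    toG R (eliminate e t (letterInv l)) = (toG R (eliminate e t l))⁻¹ := by
  by_cases h : l = e
  · subst h
    simp [eliminate, letterInv_ne, toG_invRev]
  · by_cases h' : l = letterInv e
    · subst h'
      simp [eliminate, letterInv_ne, letterInv_letterInv, toG_invRev]
    · have h₁ : letterInv l ≠ e := fun h₁ => h' (by rw [← h₁, letterInv_letterInv])
      have h₂ : letterInv l ≠ letterInv e := fun h₂ => h (letterInv_injective h₂)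
      simp [eliminate, h, h', h₁, h₂, toG_letterInv]

theorem lift_eliminate (e : X × Bool) (t w : Word X) :
    (FreeGroup.lift fun x => toG R (eliminate e t (x, true))) (FreeGroup.mk w) =
      toG R (w.flatMap (eliminate e t)) := by
  induction w with
  | nil => exact (map_one _).trans (map_one _).symm
  | cons l w ih =>
    rw [List.flatMap_cons, toG_append, ← ih, ← List.singleton_append, ← FreeGroup.mul_mk,
      map_mul]
    congr 1
    obtain ⟨x, b⟩ := l
    cases b with
    | true => simp
    | false =>
      have := toG_eliminate_letterInv (R := R) e t (x, true)
      simpa [letterInv] using this.symm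

theorem flatMap_eliminate_of_forall {e : X × Bool} {t w : Word X} (h : ∀ l ∈ w, l.1 ≠ e.1) :
    w.flatMap (eliminate e t) = w := by
  induction w with
  | nil => rfl
  | cons l w ih =>
    rw [List.forall_mem_cons] at h
    have h₁ : l ≠ e := fun h₁ => h.1 (by rw [h₁])
    have h₂ : l ≠ letterInv e := fun h₂ => h.1 (by rw [h₂]; rfl)
    rw [List.flatMap_cons, ih h.2]
    simp [eliminate, h₁, h₂]

theorem toG_flatMap_eliminate {e : X × Bool} {t : Word X} (h : toG R (e :: t) = 1)
    (w : Word X) : toG R (w.flatMap (eliminate e t)) = toG R w := by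
  have he : toG R t = (toG R [e])⁻¹ := by
    rw [toG_cons] at h
    exact eq_inv_of_mul_eq_one_right h
  induction w with
  | nil => rfl
  | cons l w ih =>
    rw [List.flatMap_cons, toG_append, ih, toG_cons l]
    congr 1
    unfold eliminate
    split_ifs with h₁ h₂
    · rw [toG_invRev, he, inv_inv, h₁]
    · rw [he, h₂, toG_letterInv]
    · rfl

/-- A relator `e t₁ t₂ t₃` such that `e` occurs in no other relator, up to rotation and
inversion, and only once in this one. -/
structure Eliminable (R : Set (FreeGroup X)) (e t₁ t₂ t₃ : X × Bool) : Prop where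
  mem : FreeGroup.mk [e, t₁, t₂, t₃] ∈ R
  unique : ∀ {x y z}, FreeGroup.mk [e, x, y, z] ∈ R → x = t₁ ∧ y = t₂ ∧ z = t₃
  avoids : ∀ l ∈ [t₁, t₂, t₃], l.1 ≠ e.1

theorem eliminable_of_not_piece (hS : Symmetrized R) (hC : Cpp4 R) {e t₁ t₂ t₃ : X × Bool}
    (h : FreeGroup.mk [e, t₁, t₂, t₃] ∈ R) (hp : ¬ IsPiece R [e]) (h₂ : t₂ ≠ e) :
    Eliminable R e t₁ t₂ t₃ := by
  have hu : ∀ {x y z}, FreeGroup.mk [e, x, y, z] ∈ R → x = t₁ ∧ y = t₂ ∧ z = t₃ := by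
    intro x y z h'
    by_contra hne
    refine hp ⟨by simp, _, h', _, h, fun e' => hne (relator_ext hC h' h e').2,
      ⟨_, toWord_mk_of_mem hC h' rfl⟩, ⟨_, toWord_mk_of_mem hC h rfl⟩⟩
  refine ⟨h, hu, ?_⟩
  have r₁ := relator_rotate hS hC h
  have r₂ := relator_rotate hS hC r₁
  have r₃ := relator_rotate hS hC r₂
  have n₁ : t₁ ≠ e := by
    rintro rfl
    exact h₂ (hu r₁).1
  have n₃ : t₃ ≠ e := by
    rintro rfl
    exact n₁ (hu r₃).1.symm
  have m₁ : t₁ ≠ letterInv e := relator_reduced hS hC h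
  have m₃ : t₃ ≠ letterInv e := relator_cyclically_reduced hS hC h
  have m₂ : t₂ ≠ letterInv e := by
    intro m₂
    have := relator_rotate hS hC (relator_inv hS h)
    rw [m₂, letterInv_letterInv] at this
    exact letterInv_ne _ (hu this).1
  intro l hl hle
  simp only [List.mem_cons, List.not_mem_nil, or_false] at hl
  rcases eq_or_eq_letterInv hle with rfl | rfl <;> rcases hl with rfl | rfl | rfl <;> contradiction

theorem exists_eliminable (hS : Symmetrized R) (hC : Cpp4 R) {a b : X × Bool}
    (h : IsPiece R [a, b]) : ∃ e t₁ t₂ t₃, Eliminable R e t₁ t₂ t₃ := by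
  obtain ⟨-, r, hr, s, hs, hne, ⟨u, hu⟩, ⟨v, hv⟩⟩ := h
  obtain ⟨a₁, b₁, c, d, rfl, e₁⟩ := exists_letters_of_mem hC hr
  obtain ⟨a₂, b₂, c', d', rfl, e₂⟩ := exists_letters_of_mem hC hs
  rw [e₁] at hu
  rw [e₂] at hv
  obtain ⟨rfl, rfl, -⟩ : a₁ = a ∧ b₁ = b ∧ _ := by simpa using hu
  obtain ⟨rfl, rfl, -⟩ : a₂ = a₁ ∧ b₂ = b₁ ∧ _ := by simpa using hv
  have r₁ := relator_rotate hS hC hr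
  have s₁ := relator_rotate hS hC hs
  have ha : IsPiece R [a₂] := ⟨by simp, _, hr, _, hs, hne, ⟨_, e₁⟩, ⟨_, e₂⟩⟩
  have hb : IsPiece R [b₂] := by
    refine ⟨by simp, _, r₁, _, s₁, fun e => hne ?_, ⟨_, toWord_mk_of_mem hC r₁ rfl⟩,
      ⟨_, toWord_mk_of_mem hC s₁ rfl⟩⟩
    obtain ⟨-, h₁, h₂, -⟩ := relator_ext hC r₁ s₁ e
    rw [h₁, h₂]
  have hab : IsPiece R [a₂, b₂] := ⟨by simp, _, hr, _, hs, hne, ⟨_, e₁⟩, ⟨_, e₂⟩⟩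
  have r₂ := relator_rotate hS hC r₁
  have r₃ := relator_rotate hS hC r₂
  by_cases hc : IsPiece R [c]
  · have hd : ¬ IsPiece R [d] := fun hd =>
      hC.2 _ hr ⟨[[a₂, b₂], [c], [d]], by simp, by simp [hab, hc, hd], e₁⟩
    exact ⟨_, _, _, _, eliminable_of_not_piece hS hC r₃ hd (fun h => hd (h ▸ hb))⟩
  · exact ⟨_, _, _, _, eliminable_of_not_piece hS hC r₂ hc (fun h => hc (h ▸ ha))⟩

theorem Eliminable.relatorsAvoiding_ssubset (hC : Cpp4 R) {e t₁ t₂ t₃ : X × Bool}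
    (h : Eliminable R e t₁ t₂ t₃) : relatorsAvoiding R e.1 ⊂ R := by
  refine ⟨relatorsAvoiding_subset _, fun hsub => ?_⟩
  refine (hsub h.mem).2 e ?_ rfl
  rw [toWord_mk_of_mem hC h.mem rfl]
  simp

theorem Eliminable.lift_eq_one (hS : Symmetrized R) (hC : Cpp4 R) {e t₁ t₂ t₃ : X × Bool}
    (h : Eliminable R e t₁ t₂ t₃) {r : FreeGroup X} (hr : r ∈ R) :
    (FreeGroup.lift fun x =>
      toG (relatorsAvoiding R e.1) (eliminate e [t₁, t₂, t₃] (x, true))) r = 1 := by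
  set φ := FreeGroup.lift fun x =>
    toG (relatorsAvoiding R e.1) (eliminate e [t₁, t₂, t₃] (x, true)) with hφ
  have hrot : ∀ {a b c d}, φ (FreeGroup.mk [b, c, d, a]) = 1 →
      φ (FreeGroup.mk [a, b, c, d]) = 1 := by
    intro a b c d h'
    have e₁ : FreeGroup.mk [a, b, c, d] = FreeGroup.mk [a] * FreeGroup.mk [b, c, d] := by
      rw [FreeGroup.mul_mk]
      rfl
    have e₂ : FreeGroup.mk [b, c, d, a] = FreeGroup.mk [b, c, d] * FreeGroup.mk [a] := by
      rw [FreeGroup.mul_mk]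
      rfl
    rw [e₁, map_mul, mul_eq_one_comm, ← map_mul, ← e₂]
    exact h'
  have head : ∀ {x y z}, FreeGroup.mk [e, x, y, z] ∈ R → φ (FreeGroup.mk [e, x, y, z]) = 1 := by
    intro x y z h'
    obtain ⟨rfl, rfl, rfl⟩ := h.unique h'
    rw [hφ, lift_eliminate, List.flatMap_cons, flatMap_eliminate_of_forall h.avoids, toG_append]
    simp [eliminate, toG_invRev]
  have key : ∀ {a b c d}, FreeGroup.mk [a, b, c, d] ∈ R → e ∈ [a, b, c, d] →
      φ (FreeGroup.mk [a, b, c, d]) = 1 := by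
    intro a b c d h' he
    have r₁ := relator_rotate hS hC h'
    have r₂ := relator_rotate hS hC r₁
    have r₃ := relator_rotate hS hC r₂
    simp only [List.mem_cons, List.not_mem_nil, or_false] at he
    rcases he with rfl | rfl | rfl | rfl
    · exact head h'
    · exact hrot (head r₁)
    · exact hrot (hrot (head r₂))
    · exact hrot (hrot (hrot (head r₃)))
  by_cases hr' : r ∈ relatorsAvoiding R e.1
  · rw [← FreeGroup.mk_toWord (x := r), hφ, lift_eliminate, flatMap_eliminate_of_forall hr'.2]
    exact toG_relator (by rwa [FreeGroup.mk_toWord])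
  · obtain ⟨l, hl, hle⟩ : ∃ l ∈ r.toWord, l.1 = e.1 := by
      by_contra! hcon
      exact hr' ⟨hr, hcon⟩
    obtain ⟨a, b, c, d, rfl, e₁⟩ := exists_letters_of_mem hC hr
    rw [e₁] at hl
    rcases eq_or_eq_letterInv hle with rfl | rfl
    · exact key hr hl
    · have h' := key (relator_inv hS hr) (by
        simp only [List.mem_cons, List.not_mem_nil, or_false] at hl ⊢
        rcases hl with rfl | rfl | rfl | rfl <;> simp [letterInv_letterInv])
      rw [← inv_eq_one, ← map_inv, FreeGroup.inv_mk]
      exact h'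

theorem Eliminable.isConj_iff (hS : Symmetrized R) (hC : Cpp4 R) {e t₁ t₂ t₃ : X × Bool}
    (h : Eliminable R e t₁ t₂ t₃) (u w : Word X) :
    IsConj (toG R u) (toG R w) ↔
      IsConj (toG (relatorsAvoiding R e.1) (u.flatMap (eliminate e [t₁, t₂, t₃])))
        (toG (relatorsAvoiding R e.1) (w.flatMap (eliminate e [t₁, t₂, t₃]))) := by
  let Φ := PresentedGroup.toGroup fun r hr => h.lift_eq_one hS hC hr
  have hΦ : ∀ v, Φ (toG R v) = toG (relatorsAvoiding R e.1)
      (v.flatMap (eliminate e [t₁, t₂, t₃])) := fun v => lift_eliminate e _ v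
  let Ψ : PresentedGroup (relatorsAvoiding R e.1) →* PresentedGroup R :=
    QuotientGroup.map _ _ (MonoidHom.id _)
      (Subgroup.normalClosure_mono (relatorsAvoiding_subset e.1))
  have hΨ : ∀ v, Ψ (toG (relatorsAvoiding R e.1) v) = toG R v := fun v => rfl
  constructor
  · intro h'
    rw [← hΦ, ← hΦ]
    exact Φ.map_isConj h'
  · intro h'
    have := Ψ.map_isConj h'
    rwa [hΨ, hΨ, toG_flatMap_eliminate (toG_relator h.mem),
      toG_flatMap_eliminate (toG_relator h.mem)] at this

end Elimination

theorem exists_eq_succ_of_monotone {α : Type*} {f : ℕ → Finset α} (hf : Monotone f)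
    {T : Finset α} (h : ∀ k, f k ⊆ T) : ∃ k ≤ T.card, f k = f (k + 1) := by
  by_contra! hne
  have key : ∀ k ≤ T.card + 1, k ≤ (f k).card := by
    intro k
    induction k with
    | zero => simp
    | succ k ih =>
      intro hk
      have h₁ := ih (by omega)
      have h₂ := Finset.card_lt_card ((hf k.le_succ).ssubset_of_ne (hne k (by omega)))
      rw [Nat.succ_eq_add_one] at h₂
      omega
  have h₁ := key _ le_rfl
  have h₂ := Finset.card_le_card (h (T.card + 1))
  omega

theorem card_words_le {A : Type*} [Fintype A] {N : ℕ} {T : Finset (List A)}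
    (h : ∀ w ∈ T, w.length ≤ N) : T.card ≤ (Fintype.card A + 1) ^ N := by
  have hinj : Function.Injective fun (w : T) (i : Fin N) => w.1[(i : ℕ)]? := by
    rintro ⟨v, hv⟩ ⟨w, hw⟩ e
    refine Subtype.ext (List.ext_getElem? fun i => ?_)
    rcases lt_or_ge i N with hi | hi
    · exact congrFun e ⟨i, hi⟩
    · rw [List.getElem?_eq_none ((h v hv).trans hi), List.getElem?_eq_none ((h w hw).trans hi)]
  simpa using Fintype.card_le_of_injective _ hinj

namespace SquareSystem

variable {A : Type*} (S : SquareSystem A)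

/-- The replacements that elementary moves perform at the head of a word. -/
def Rule (r : List A × List A) : Prop :=
  (∃ x x' y y', S.Sq x x' y y' ∧ r = ([x, x'], [y, y'])) ∨
    (∃ a, r = ([a, S.inv a], [])) ∨ ∃ a, r = ([], [a, S.inv a])

theorem finite_rules [Finite A] : {r | S.Rule r}.Finite := by
  have h := List.finite_length_le A 2
  refine (h.prod h).subset ?_
  rintro r (⟨x, x', y, y', -, rfl⟩ | ⟨a, rfl⟩ | ⟨a, rfl⟩) <;> simp

section Search

variable [DecidableEq A]

/-- Apply a replacement at the head of a word, when possible. -/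
def applyRule (v : List A) (r : List A × List A) : List A :=
  if v.take r.1.length = r.1 then r.2 ++ v.drop r.1.length else v

/-- The results of rotating a word and of applying the given replacements to it. -/
def neighbours (rules : List (List A × List A)) (v : List A) : List (List A) :=
  (v.tail ++ v.take 1) :: rules.map (applyRule v)

/-- Add to a list of words all the neighbours of length at most `N`. -/
def expand (rules : List (List A × List A)) (N : ℕ) (L : List (List A)) : List (List A) :=
  L ++ L.flatMap fun v => (neighbours rules v).flatMap fun w => if w.length ≤ N then [w] else []

theorem mem_expand {rules : List (List A × List A)} {N : ℕ} {L : List (List A)} {w : List A} :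
    w ∈ expand rules N L ↔ w ∈ L ∨ w.length ≤ N ∧ ∃ v ∈ L, w ∈ neighbours rules v := by
  simp only [expand, List.mem_append, List.mem_flatMap]
  refine or_congr_right ⟨?_, ?_⟩
  · rintro ⟨v, hv, w', hw', h⟩
    split_ifs at h with hN
    · obtain rfl := List.mem_singleton.1 h
      exact ⟨hN, v, hv, hw'⟩
    · simp at h
  · rintro ⟨hN, v, hv, hw⟩
    exact ⟨v, hv, w, hw, by simp [hN]⟩

variable {S}

theorem mem_neighbours_of_cycStep {rules : List (List A × List A)}
    (hr : ∀ r, S.Rule r → r ∈ rules) {v w : List A} (h : S.CycStep v w) :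
    w ∈ neighbours rules v := by
  cases h with
  | rotate a t => simp [neighbours]
  | exchange t h =>
    exact List.mem_cons_of_mem _
      (List.mem_map.2 ⟨_, hr _ (.inl ⟨_, _, _, _, h, rfl⟩), by simp [applyRule]⟩)
  | cancel a t =>
    exact List.mem_cons_of_mem _
      (List.mem_map.2 ⟨_, hr _ (.inr (.inl ⟨a, rfl⟩)), by simp [applyRule]⟩)
  | insert a t =>
    exact List.mem_cons_of_mem _
      (List.mem_map.2 ⟨_, hr _ (.inr (.inr ⟨a, rfl⟩)), by simp [applyRule]⟩)

theorem eq_or_cycStep_of_mem_neighbours {rules : List (List A × List A)}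
    (hr : ∀ r ∈ rules, S.Rule r) {v w : List A} (h : w ∈ neighbours rules v) :
    w = v ∨ S.CycStep v w := by
  rcases List.mem_cons.1 h with rfl | h
  · cases v with
    | nil => exact .inl rfl
    | cons a t => exact .inr (by simpa using CycStep.rotate a t)
  · obtain ⟨r, hmem, rfl⟩ := List.mem_map.1 h
    unfold applyRule
    split_ifs with hv
    · right
      generalize ht : v.drop r.1.length = t
      obtain rfl : v = r.1 ++ t := by rw [← List.take_append_drop r.1.length v, hv, ht]
      rcases hr r hmem with ⟨x, x', y, y', hs, rfl⟩ | ⟨a, rfl⟩ | ⟨a, rfl⟩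
      · exact .exchange t hs
      · exact .cancel a t
      · exact .insert a t
    · exact .inl rfl

theorem mem_iterate_expand_iff [Fintype A] {rules : List (List A × List A)}
    (hr : ∀ r, r ∈ rules ↔ S.Rule r) {N : ℕ} {u w : List A} (hu : u.length ≤ N) :
    w ∈ (expand rules N)^[(Fintype.card A + 1) ^ N] [u] ↔ S.Conn N u w := by
  have sound : ∀ k, ∀ v ∈ (expand rules N)^[k] [u], v.length ≤ N ∧ S.Conn N u v := by
    intro k
    induction k with
    | zero =>
      intro v hv
      obtain rfl := List.mem_singleton.1 hv
      exact ⟨hu, .refl⟩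
    | succ k ih =>
      intro v hv
      rw [Function.iterate_succ_apply', mem_expand] at hv
      rcases hv with hv | ⟨hN, v', hv', h⟩
      · exact ih v hv
      · obtain ⟨h₁, h₂⟩ := ih v' hv'
        refine ⟨hN, ?_⟩
        rcases eq_or_cycStep_of_mem_neighbours (fun r => (hr r).1) h with rfl | h
        · exact h₂
        · exact h₂.tail ⟨h, h₁, hN⟩
  refine ⟨fun h => (sound _ w h).2, fun h => ?_⟩
  let T : Finset (List A) := (List.finite_length_le A N).toFinset
  let f : ℕ → Finset (List A) := fun k => ((expand rules N)^[k] [u]).toFinset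
  have hf : Monotone f := by
    refine monotone_nat_of_le_succ fun k v hv => ?_
    rw [List.mem_toFinset] at hv ⊢
    rw [Function.iterate_succ_apply', mem_expand]
    exact .inl hv
  obtain ⟨k, hk, hstable⟩ := exists_eq_succ_of_monotone hf (T := T) fun k v hv => by
    simpa [T] using (sound k v (List.mem_toFinset.1 hv)).1
  have hmem : w ∈ f k := by
    induction h with
    | refl =>
      exact hf (Nat.zero_le k) (by simp [f])
    | tail _ hs ih =>
      obtain ⟨hs, -, hN⟩ := hs
      rw [hstable, List.mem_toFinset, Function.iterate_succ_apply', mem_expand]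
      exact .inr ⟨hN, _, List.mem_toFinset.1 ih,
        mem_neighbours_of_cycStep (fun r => (hr r).2) hs⟩
  have hT : T.card ≤ (Fintype.card A + 1) ^ N :=
    card_words_le fun v hv => by simpa [T] using hv
  exact List.mem_toFinset.1 (hf (hk.trans hT) hmem)

end Search

section Computability

variable [Primcodable A] [DecidableEq A]

theorem primrec_applyRule : Primrec₂ (applyRule (A := A)) := by
  have hl : Primrec fun p : List A × List A × List A => p.2.1.length :=
    Primrec.list_length.comp (Primrec.fst.comp Primrec.snd)
  refine Primrec.ite ?_ ?_ Primrec.fst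
  · exact Primrec.eq.comp (Primrec.list_take.comp hl Primrec.fst)
      (Primrec.fst.comp Primrec.snd)
  · exact Primrec.list_append.comp (Primrec.snd.comp Primrec.snd)
      (Primrec.list_drop.comp hl Primrec.fst)

theorem primrec_neighbours (rules : List (List A × List A)) : Primrec (neighbours rules) :=
  Primrec.list_cons.comp
    (Primrec.list_append.comp Primrec.list_tail
      (Primrec.list_take.comp (Primrec.const 1) Primrec.id))
    (Primrec.list_map (Primrec.const rules) primrec_applyRule)

theorem primrec_expand (rules : List (List A × List A)) : Primrec₂ (expand rules) := by
  refine Primrec.list_append.comp Primrec.snd (Primrec.list_flatMap Primrec.snd ?_)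
  refine Primrec.list_flatMap ((primrec_neighbours rules).comp Primrec.snd) ?_
  refine Primrec.ite ?_ (Primrec.list_cons.comp Primrec.snd (Primrec.const [])) (Primrec.const [])
  exact Primrec.nat_le.comp (Primrec.list_length.comp Primrec.snd)
    (Primrec.fst.comp (Primrec.fst.comp Primrec.fst))

theorem exists_primrec_conn [Finite A] (S : SquareSystem A) :
    ∃ f : List A × List A → Bool, Primrec f ∧
      ∀ u w, f (u, w) = true ↔ S.Conn (2 * u.length + w.length + 4) u w := by
  have := Fintype.ofFinite A
  let rules := S.finite_rules.toFinset.toList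
  let N : List A × List A → ℕ := fun p => 2 * p.1.length + p.2.length + 4
  let K : List A × List A → ℕ := fun p => (· * (Fintype.card A + 1))^[N p] 1
  have hN : Primrec N := Primrec.nat_add.comp
    (Primrec.nat_add.comp
      (Primrec.nat_mul.comp (Primrec.const 2) (Primrec.list_length.comp Primrec.fst))
      (Primrec.list_length.comp Primrec.snd)) (Primrec.const 4)
  have hK : Primrec K := Primrec.nat_iterate hN (Primrec.const 1)
    (Primrec.nat_mul.comp Primrec.snd (Primrec.const _))
  have hE : Primrec fun p : List A × List A => (expand rules (N p))^[K p] [p.1] :=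
    Primrec.nat_iterate hK (Primrec.list_cons.comp Primrec.fst (Primrec.const []))
      ((primrec_expand rules).comp (hN.comp Primrec.fst) Primrec.snd)
  have hM : PrimrecPred fun p : List A × List A =>
      ∃ v ∈ (expand rules (N p))^[K p] [p.1], v = p.2 :=
    (Primrec.eq (α := List A)).exists_mem_list.comp hE Primrec.snd
  obtain ⟨_, hM⟩ := hM
  refine ⟨_, hM, fun u w => ?_⟩
  rw [decide_eq_true_iff, ← mem_iterate_expand_iff (rules := rules)
    (fun r => by simp [rules]) (by omega)]
  simp only [exists_eq_right, K, N, mul_right_iterate, one_mul]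

end Computability

end SquareSystem

theorem exists_primrec_isConj {X : Type*} [Primcodable X] [DecidableEq X] [Finite X]
    {R : Set (FreeGroup X)} (hR : R.Finite) (hS : Symmetrized R) (hC : Cpp4 R) (hT : T4 R) :
    ∃ f : Word X × Word X → Bool, Primrec f ∧
      ∀ u w, f (u, w) = true ↔ IsConj (toG R u) (toG R w) := by
  induction hn : R.ncard using Nat.strong_induction_on generalizing R with
  | _ n ih =>
    by_cases hP : ∃ a b, IsPiece R [a, b]
    · obtain ⟨a, b, hab⟩ := hP
      obtain ⟨e, t₁, t₂, t₃, h⟩ := exists_eliminable hS hC hab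
      have hss := h.relatorsAvoiding_ssubset hC
      obtain ⟨f, hf, hf'⟩ := ih _ (hn ▸ Set.ncard_lt_ncard hss hR) (hR.subset hss.1)
        (symmetrized_relatorsAvoiding hS hC e.1) (hC.mono hss.1) (hT.mono hss.1) rfl
      have hσ : Primrec fun w : Word X => w.flatMap (eliminate e [t₁, t₂, t₃]) :=
        Primrec.list_flatMap Primrec.id ((Primrec.dom_finite _).comp Primrec.snd)
      refine ⟨_, hf.comp ((hσ.comp Primrec.fst).pair (hσ.comp Primrec.snd)), fun u w => ?_⟩
      rw [hf', ← h.isConj_iff hS hC]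
    · push Not at hP
      obtain ⟨f, hf, hf'⟩ := (squareSystem hS hC hT hP).exists_primrec_conn
      exact ⟨f, hf, fun u w => (hf' u w).trans (isConj_toG_iff hS hC hT hP u w).symm⟩

/-- The conjugacy problem for a group given by a finite symmetrized C''(4)–T(4)
presentation over a finite alphabet (with decidable equality) is decidable: there is a
computable function deciding whether two words represent conjugate elements. -/
theorem conjugacyProblem_decidable {m : ℕ} (R : Finset (FreeGroup (Fin m)))
    (hsym : Symmetrized (R : Set (FreeGroup (Fin m))))
    (hC : Cpp4 (R : Set (FreeGroup (Fin m))))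
    (hT : T4 (R : Set (FreeGroup (Fin m)))) :
    ∃ f : Word (Fin m) × Word (Fin m) → Bool, Computable f ∧
      ∀ u w : Word (Fin m), f (u, w) = true ↔
        IsConj (toG (R : Set (FreeGroup (Fin m))) u)
          (toG (R : Set (FreeGroup (Fin m))) w) := by
  obtain ⟨f, hf, h⟩ := exists_primrec_isConj R.finite_toSet hsym hC hT
  exact ⟨f, hf.to_comp, h⟩
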